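/- arXiv:1504.08107 — 3 statements merged into one kernel-verified Lean document; each statement's English description precedes it below -/
import Mathlib

section
/- Let $l$ be a non-negative integer and let $G$ be a graph whose vertices are each assigned a subset of the colour set $\{red, green\}$. Suppose $G$ does not contain $l+1$ pairwise vertex-disjoint connected subgraphs each containing both a red-coloured vertex and a green-coloured vertex. Then there is a set $S$ of at most $l$ vertices such that every connected component of $G - S$ contains vertices of at most one of the two colours. -/
/-- Vertices reachable from `A` by a walk avoiding `S`. -/
inductive Rch {V : Type*} (G : SimpleGraph V) (A S : Set V) : V → Prop
  | base (a : V) : a ∈ A → a ∉ S → Rch G A S a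
  | step (v w : V) : Rch G A S v → G.Adj v w → w ∉ S → Rch G A S w

theorem Rch.notMem {V : Type*} {G : SimpleGraph V} {A S : Set V} {v : V}
    (h : Rch G A S v) : v ∉ S := by
  cases h <;> assumption

theorem Rch.meet {V : Type*} {G : SimpleGraph V} {A B S : Set V} {v : V}
    (h : Rch G B S v) (h' : Rch G A S v) : ∃ b ∈ B, Rch G A S b := by
  induction h with
  | base a ha _ => exact ⟨a, ha, h'⟩
  | step v w hv hvw hw ih => exact ih (Rch.step w v h' hvw.symm hv.notMem)

theorem Rch.walk {V : Type*} {G : SimpleGraph V} {A S : Set V} {u v : V}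
    (p : G.Walk u v) (hu : Rch G A S u) (hp : ∀ w ∈ p.support, w ∉ S) : Rch G A S v := by
  induction p with
  | nil => exact hu
  | cons hadj p ih =>
    refine ih (Rch.step _ _ hu hadj (hp _ ?_)) (fun w hw => hp w ?_) <;> simp [*]

def SepBy {V : Type*} (G : SimpleGraph V) (A B S : Set V) : Prop :=
  ∀ b ∈ B, ¬ Rch G A S b

theorem SepBy.symm {V : Type*} {G : SimpleGraph V} {A B S : Set V} (h : SepBy G A B S) :
    SepBy G B A S := by
  intro a ha hr
  obtain ⟨b, hb, hb'⟩ := Rch.meet hr (Rch.base (A := A) a ha hr.notMem)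
  exact h b hb hb'

def Linked {V : Type*} (G : SimpleGraph V) (A B : Set V) (ι : Type*) : Prop :=
  ∃ C : ι → Set V, (∀ i, ∃ a ∈ A, ∃ b ∈ B, ∃ p : G.Walk a b, ∀ v ∈ p.support, v ∈ C i) ∧
    ∀ i j, ∀ v, v ∈ C i → v ∈ C j → i = j

theorem Linked.reindex {V ι κ : Type*} {G : SimpleGraph V} {A B : Set V}
    (h : Linked G A B ι) (f : κ → ι) (hf : Function.Injective f) : Linked G A B κ := by
  obtain ⟨C, h1, h2⟩ := h
  exact ⟨fun i => C (f i), fun i => h1 _, fun i j v hi hj => hf (h2 _ _ v hi hj)⟩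

theorem Linked.endpoints {V : Type*} {G : SimpleGraph V} {A : Set V} {X : Finset V} {k : ℕ}
    (h : Linked G A (X : Set V) (Fin k)) (hX : X.card ≤ k) :
    k = X.card ∧ ∃ C : V → Set V,
      (∀ s ∈ X, ∃ a ∈ A, ∃ p : G.Walk a s, p.IsPath ∧ ∀ v ∈ p.support, v ∈ C s) ∧
      ∀ s ∈ X, ∀ t ∈ X, ∀ v, v ∈ C s → v ∈ C t → s = t := by
  classical
  obtain ⟨C, h1, h2⟩ := h
  choose a ha b hb p hp using h1
  let g : Fin k → X := fun i => ⟨b i, hb i⟩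
  have hg : Function.Injective g := by
    intro i j hij
    have hij' : b i = b j := congrArg Subtype.val hij
    refine h2 i j (b i) (hp i _ (by simp)) ?_
    rw [hij']
    exact hp j _ (by simp)
  have hk : k = X.card := by
    refine le_antisymm ?_ hX
    simpa using Fintype.card_le_of_injective g hg
  have hbij : Function.Bijective g :=
    (Fintype.bijective_iff_injective_and_card g).2 ⟨hg, by simpa using hk⟩
  refine ⟨hk, fun s => {v | ∃ i, b i = s ∧ v ∈ C i}, ?_, ?_⟩
  · intro s hs
    obtain ⟨i, hi⟩ := hbij.2 ⟨s, hs⟩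
    have hi' : b i = s := congrArg Subtype.val hi
    subst hi'
    exact ⟨a i, ha i, (p i).bypass, (p i).bypass_isPath,
      fun v hv => ⟨i, rfl, hp i v ((p i).support_bypass_subset_support hv)⟩⟩
  · rintro s hs t ht v ⟨i, rfl, hi⟩ ⟨j, rfl, hj⟩
    rw [h2 i j v hi hj]

/-- A family of disjoint paths into `X` meets `X` only in endpoints, so the other vertices
are reachable avoiding `X`. -/
theorem path_rch {V : Type*} {G : SimpleGraph V} {A : Set V} {X : Finset V} {C : V → Set V}
    (hC : ∀ s ∈ X, ∃ a ∈ A, ∃ p : G.Walk a s, p.IsPath ∧ ∀ v ∈ p.support, v ∈ C s)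
    (hd : ∀ s ∈ X, ∀ t ∈ X, ∀ v, v ∈ C s → v ∈ C t → s = t)
    {s a : V} (hs : s ∈ X) (ha : a ∈ A) (p : G.Walk a s) (hp : p.IsPath)
    (hpC : ∀ v ∈ p.support, v ∈ C s) {v : V} (hv : v ∈ p.support) :
    v = s ∨ Rch G A (X : Set V) v := by
  classical
  by_cases hvs : v = s
  · exact Or.inl hvs
  right
  have key : ∀ w ∈ (p.takeUntil v hv).support, w ∉ (X : Set V) := by
    intro w hw hwX
    have h1 := hpC w (p.support_takeUntil_subset_support hv hw)
    obtain ⟨_, _, q, _, hq⟩ := hC w hwX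
    have : s = w := hd s hs w hwX w h1 (hq w (by simp))
    subst this
    exact SimpleGraph.Walk.endpoint_notMem_support_takeUntil hp hv (Ne.symm hvs) hw
  exact Rch.walk (p.takeUntil v hv) (Rch.base a ha (key a (by simp))) key

theorem sep_lift {V : Type*} {G G' : SimpleGraph V} {A B S T : Set V} {x y : V}
    (hG : ∀ u v, G.Adj u v → G'.Adj u v ∨ (u = x ∧ v = y) ∨ (u = y ∧ v = x))
    (hS : SepBy G' A B S) (hy : Rch G' B S y) 
    (hT : SepBy G' A (insert x S) T) : SepBy G A B T := by
  have h1 : ∀ v, Rch G' A T v → Rch G' A S v := by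
    intro v hv
    induction hv with
    | base a ha haT => exact Rch.base a ha (fun h => hT a (Or.inr h) (Rch.base a ha haT))
    | step v w hv hvw hw ih =>
      exact Rch.step v w ih hvw (fun h => hT w (Or.inr h) (Rch.step v w hv hvw hw))
  have h2 : ∀ v, Rch G A T v → Rch G' A T v := by
    intro v hv
    induction hv with
    | base a ha haT => exact Rch.base a ha haT
    | step v w hv hvw hw ih =>
      rcases hG v w hvw with h | ⟨rfl, rfl⟩ | ⟨rfl, rfl⟩
      · exact Rch.step v w ih h hw
      · exact absurd ih (hT _ (Or.inl rfl))
      · obtain ⟨b, hb, hb'⟩ := Rch.meet hy (h1 _ ih)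
        exact absurd hb' (hS b hb)
  intro b hb hr
  exact hS b hb (h1 _ (h2 _ hr))

theorem Linked.symm {V ι : Type*} {G : SimpleGraph V} {A B : Set V}
    (h : Linked G A B ι) : Linked G B A ι := by
  obtain ⟨C, h1, h2⟩ := h
  refine ⟨C, fun i => ?_, h2⟩
  obtain ⟨a, ha, b, hb, p, hp⟩ := h1 i
  exact ⟨b, hb, a, ha, p.reverse, by simpa using hp⟩

theorem menger_step {V : Type*} {G G' : SimpleGraph V} {A B : Set V} {S : Finset V} {x y : V}
    {k : ℕ} (hle : G' ≤ G) (hxy : G.Adj x y)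
    (hG : ∀ u v, G.Adj u v → G'.Adj u v ∨ (u = x ∧ v = y) ∨ (u = y ∧ v = x))
    (ih : ∀ A B : Set V, (∀ T : Finset V, SepBy G' A B T → k ≤ T.card) → Linked G' A B (Fin k))
    (hk : ∀ T : Finset V, SepBy G A B T → k ≤ T.card)
    (hS : SepBy G' A B S) (hSk : S.card < k)
    (hx : Rch G' A S x) (hy : Rch G' B S y) : Linked G A B (Fin k) := by
  classical
  have hxS : x ∉ S := hx.notMem
  have hyS : y ∉ S := hy.notMem
  have LA : Linked G' A ((insert x S : Finset V) : Set V) (Fin k) := by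
    refine ih _ _ (fun T hT => hk T ?_)
    rw [Finset.coe_insert] at hT
    exact sep_lift hG hS hy hT
  have LB : Linked G' B ((insert y S : Finset V) : Set V) (Fin k) := by
    refine ih _ _ (fun T hT => hk T ?_)
    rw [Finset.coe_insert] at hT
    refine (sep_lift (x := y) (y := x) ?_ hS.symm hx hT).symm
    intro u v huv
    have := hG u v huv
    tauto
  obtain ⟨hkX, C, hC, hCd⟩ := LA.endpoints (by rw [Finset.card_insert_of_notMem hxS]; omega)
  obtain ⟨hkY, D, hD, hDd⟩ := LB.endpoints (by rw [Finset.card_insert_of_notMem hyS]; omega)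
  have hC' := hC
  have hD' := hD
  choose! a ha p hp hpC using hC
  choose! b hb q hq hqD using hD
  have hPQ : ∀ s (hs : s ∈ insert x S), ∀ t (ht : t ∈ insert y S), ∀ v,
      v ∈ (p s hs).support → v ∈ (q t ht).support → v = s ∧ v = t ∧ v ∈ S := by
    intro s hs t ht v hv hv'
    have e1 : (v = s ∧ v ∈ S) ∨ Rch G' A S v := by
      rcases path_rch hC' hCd hs (ha s hs) _ (hp s hs) (hpC s hs) hv with h | h
      · by_cases hvS : v ∈ S
        · exact Or.inl ⟨h, hvS⟩
        · subst h
          rcases Finset.mem_insert.1 hs with h | h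
          · subst h; exact Or.inr hx
          · exact absurd h hvS
      · right
        clear hv hv'
        have mono : ∀ w, Rch G' A ((insert x S : Finset V) : Set V) w → Rch G' A S w := by
          intro w hw
          induction hw with
          | base a ha h => exact Rch.base a ha (fun h' => h (by simp at h' ⊢; tauto))
          | step v w _ hvw h ih => exact Rch.step v w ih hvw (fun h' => h (by simp at h' ⊢; tauto))
        exact mono v h
    have e2 : (v = t ∧ v ∈ S) ∨ Rch G' B S v := by
      rcases path_rch hD' hDd ht (hb t ht) _ (hq t ht) (hqD t ht) hv' with h | h
      · by_cases hvS : v ∈ S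
        · exact Or.inl ⟨h, hvS⟩
        · subst h
          rcases Finset.mem_insert.1 ht with h | h
          · subst h; exact Or.inr hy
          · exact absurd h hvS
      · right
        clear hv hv'
        have mono : ∀ w, Rch G' B ((insert y S : Finset V) : Set V) w → Rch G' B S w := by
          intro w hw
          induction hw with
          | base a ha h => exact Rch.base a ha (fun h' => h (by simp at h' ⊢; tauto))
          | step v w _ hvw h ih => exact Rch.step v w ih hvw (fun h' => h (by simp at h' ⊢; tauto))
        exact mono v h
    rcases e1 with ⟨e1, h1⟩ | e1 <;> rcases e2 with ⟨e2, h2⟩ | e2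
    · exact ⟨e1, e2, h1⟩
    · exact absurd h1 e2.notMem
    · exact absurd h2 e1.notMem
    · obtain ⟨b, hb, hb'⟩ := Rch.meet e2 e1
      exact absurd hb' (hS b hb)
  let t : V → V := fun s => if s = x then y else s
  have ht : ∀ s ∈ insert x S, t s ∈ insert y S := by
    intro s hs
    simp only [t]
    split_ifs with h
    · simp
    · simp at hs ⊢; tauto
  have htinj : ∀ s ∈ insert x S, ∀ s' ∈ insert x S, t s = t s' → s = s' := by
    intro s hs s' hs'
    simp only [t, Finset.mem_insert] at *
    split_ifs with h h' h'
    · intro _; rw [h, h']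
    · intro e; subst e; tauto
    · intro e; subst e; tauto
    · exact id
  have hmid : ∀ s, ∃ e : G.Walk s (t s), ∀ v ∈ e.support, v = s ∨ v = t s := by
    intro s
    by_cases h : s = x
    · subst h
      have : t s = y := by simp [t]
      rw [this]
      exact ⟨SimpleGraph.Walk.cons hxy SimpleGraph.Walk.nil, by simp⟩
    · have : t s = s := by simp [t, h]
      rw [this]
      exact ⟨SimpleGraph.Walk.nil, by simp⟩
  have LX : Linked G A B (insert x S : Finset V) := by
    refine ⟨fun s => {v | v ∈ (p s.1 s.2).support ∨ v ∈ (q (t s.1) (ht s.1 s.2)).support}, ?_, ?_⟩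
    · rintro ⟨s, hs⟩
      obtain ⟨e, he⟩ := hmid s
      refine ⟨a s, ha s hs, b (t s), hb _ (ht s hs),
        (((p s hs).mapLe hle).append e).append (((q (t s) (ht s hs)).mapLe hle).reverse), ?_⟩
      intro v hv
      simp only [SimpleGraph.Walk.mem_support_append_iff, SimpleGraph.Walk.support_reverse,
        List.mem_reverse, SimpleGraph.Walk.support_mapLe_eq_support] at hv
      rcases hv with (hv | hv) | hv
      · exact Or.inl hv
      · rcases he v hv with rfl | rfl
        · exact Or.inl (by simp)
        · exact Or.inr (by simp)
      · exact Or.inr hv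
    · have cross : ∀ s (hs : s ∈ insert x S), ∀ s' (hs' : s' ∈ insert x S), ∀ v,
          v ∈ (p s hs).support → v ∈ (q (t s') (ht s' hs')).support → s = s' := by
        intro s hs s' hs' v hv hv'
        obtain ⟨h1, h2, h3⟩ := hPQ s hs _ (ht s' hs') v hv hv'
        apply htinj s hs s' hs'
        rw [← h2, ← h1]
        have : v ≠ x := by rintro rfl; exact hxS h3
        simp [t, this]
      rintro ⟨s, hs⟩ ⟨s', hs'⟩ v hv hv'
      apply Subtype.ext
      change s = s'
      rcases hv with hv | hv <;> rcases hv' with hv' | hv'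
      · exact hCd s hs s' hs' v (hpC s hs v hv) (hpC s' hs' v hv')
      · exact cross s hs s' hs' v hv hv'
      · exact (cross s' hs' s hs v hv' hv).symm
      · exact htinj s hs s' hs'
          (hDd _ (ht s hs) _ (ht s' hs') v (hqD _ _ v hv) (hqD _ _ v hv'))
  have eqv : Fin k ≃ (insert x S : Finset V) := Fintype.equivOfCardEq (by simpa using hkX)
  exact LX.reindex eqv eqv.injective

/-- Menger's theorem for finite graphs. -/
theorem menger {V : Type*} [Finite V] (G : SimpleGraph V) (k : ℕ) : ∀ (A B : Set V),
    (∀ T : Finset V, SepBy G A B T → k ≤ T.card) → Linked G A B (Fin k) := by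
  classical
  have := Fintype.ofFinite V
  induction G using WellFoundedLT.induction with
  | ind G ih =>
  intro A B hk
  by_cases hbot : ∃ x y, G.Adj x y
  · obtain ⟨x, y, hxy⟩ := hbot
    let G' := G.deleteEdges {s(x, y)}
    have hle : G' ≤ G := SimpleGraph.deleteEdges_le _
    have hlt : G' < G := by
      refine lt_of_le_of_ne hle (fun h => ?_)
      rw [← h] at hxy
      simp [G'] at hxy
    have hG : ∀ u v, G.Adj u v → G'.Adj u v ∨ (u = x ∧ v = y) ∨ (u = y ∧ v = x) := by
      intro u v huv
      simp only [G', SimpleGraph.deleteEdges_adj, Set.mem_singleton_iff, Sym2.eq_iff]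
      tauto
    by_cases hT : ∀ T : Finset V, SepBy G' A B T → k ≤ T.card
    · obtain ⟨C, h1, h2⟩ := ih G' hlt A B hT
      refine ⟨C, fun i => ?_, h2⟩
      obtain ⟨a, ha, b, hb, p, hp⟩ := h1 i
      exact ⟨a, ha, b, hb, p.mapLe hle, by simpa using hp⟩
    · push Not at hT
      obtain ⟨S, hS, hSk⟩ := hT
      have hnS : ¬ SepBy G A B S := fun h => absurd (hk S h) (by omega)
      have side : ∀ A B : Set V, SepBy G' A B S → ¬ SepBy G A B S →
          Rch G' A S x ∨ Rch G' A S y := by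
        intro A B hS hnS
        by_contra hcon
        push Not at hcon
        apply hnS
        have h2 : ∀ v, Rch G A S v → Rch G' A S v := by
          intro v hv
          induction hv with
          | base a ha haT => exact Rch.base a ha haT
          | step v w hv hvw hw ih =>
            rcases hG v w hvw with h | ⟨rfl, rfl⟩ | ⟨rfl, rfl⟩
            · exact Rch.step v w ih h hw
            · exact absurd ih hcon.1
            · exact absurd ih hcon.2
        intro b hb hr
        exact hS b hb (h2 _ hr)
      have disj : ∀ v, Rch G' A S v → Rch G' B S v → False := by
        intro v h1 h2
        obtain ⟨b, hb, hb'⟩ := Rch.meet h2 h1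
        exact hS b hb hb'
      have sA := side A B hS hnS
      have sB := side B A hS.symm (fun h => hnS h.symm)
      rcases sA with sA | sA <;> rcases sB with sB | sB
      · exact (disj _ sA sB).elim
      · exact menger_step hle hxy hG (ih G' hlt) hk hS hSk sA sB
      · exact menger_step hle hxy.symm (fun u v huv => by have := hG u v huv; tauto)
          (ih G' hlt) hk hS hSk sA sB
      · exact (disj _ sA sB).elim
  · push Not at hbot
    have hc : k ≤ (A ∩ B).toFinset.card := by
      apply hk
      intro b hb hr
      cases hr with
      | base _ ha hn => exact hn (by simp [ha, hb])
      | step v _ _ h _ => exact hbot _ _ h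
    have : Nonempty (Fin k ↪ (A ∩ B).toFinset) :=
      Function.Embedding.nonempty_of_card_le (by rw [Fintype.card_fin, Fintype.card_coe]; exact hc)
    obtain ⟨f⟩ := this
    have hf : ∀ i, (f i).1 ∈ A ∩ B := fun i => by simpa using (f i).2
    refine ⟨fun i => {(f i).1}, fun i => ⟨_, (hf i).1, _, (hf i).2, SimpleGraph.Walk.nil, by simp⟩, ?_⟩
    intro i j v hi hj
    apply f.injective
    apply Subtype.ext
    rw [Set.mem_singleton_iff] at hi hj
    rw [← hi, ← hj]

/-- If a graph with red/green coloured vertices has no `l+1` pairwise disjoint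
connected subgraphs each containing both colours, then some set `S` of at most
`l` vertices meets every component of `G - S` containing both colours. -/
theorem colour_separation {V : Type*} (G : SimpleGraph V)
    (red green : V → Prop) (l : ℕ)
    (h : ¬ ∃ f : Fin (l + 1) → Set V,
        (∀ i, (G.induce (f i)).Connected ∧ (∃ v ∈ f i, red v) ∧ (∃ v ∈ f i, green v)) ∧
        Pairwise (Function.onFun Disjoint f)) :
    ∃ S : Finset V, S.card ≤ l ∧
      ∀ v w : {x : V | x ∉ S}, red v.1 → green w.1 →
        ¬ (G.induce {x : V | x ∉ S}).Reachable v w := by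
  classical
  have fin : ∀ W : Finset V, ∃ T : Finset V, T.card ≤ l ∧
      SepBy (G.induce (W : Set V)) {v | red v.1} {v | green v.1} {v | v.1 ∈ T} := by
    intro W
    by_contra hcon
    push Not at hcon
    apply h
    obtain ⟨C, h1, h2⟩ := menger (G.induce (W : Set V)) (l + 1) {v | red v.1} {v | green v.1} (by
      intro T hT
      by_contra hlt
      refine hcon (T.map ⟨Subtype.val, Subtype.val_injective⟩) (by rw [Finset.card_map]; omega) ?_
      convert hT using 1
      ext v
      simp)
    choose a ha b hb p hp using h1
    let P := fun i => (p i).map (SimpleGraph.Embedding.induce (W : Set V)).toHom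
    refine ⟨fun i => {v | v ∈ (P i).support}, fun i => ⟨?_, ⟨(a i).1, ?_, ha i⟩, ⟨(b i).1, ?_, hb i⟩⟩, ?_⟩
    · exact (P i).connected_induce_support
    · exact (P i).start_mem_support
    · exact (P i).end_mem_support
    · intro i j hij
      refine Set.disjoint_left.2 ?_
      intro v hv hv'
      simp only [P, SimpleGraph.Walk.support_map, Set.mem_ofPred_eq, List.mem_map] at hv hv'
      obtain ⟨u, hu, rfl⟩ := hv
      obtain ⟨u', hu', he⟩ := hv'
      have : u' = u := Subtype.ext he
      subst this
      exact hij (h2 i j u' (hp i _ hu) (hp j _ hu'))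
  choose T hTc hT using fin
  let U : Ultrafilter (Finset V) := Ultrafilter.of Filter.atTop
  have hU : (U : Filter (Finset V)) ≤ Filter.atTop := Ultrafilter.of_le _
  let S : Set V := {v | ∀ᶠ W in (U : Filter (Finset V)), v ∈ T W}
  have hSc : ∀ t : Finset V, (t : Set V) ⊆ S → t.card ≤ l := by
    intro t ht
    have : ∀ᶠ W in (U : Filter (Finset V)), ∀ v ∈ t, v ∈ T W :=
      (Filter.eventually_all_finset t).2 (fun v hv => ht hv)
    obtain ⟨W, hW⟩ := this.exists
    exact (Finset.card_le_card hW).trans (hTc W)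
  have hfin : S.Finite := by
    by_contra hinf
    obtain ⟨t, ht, htc⟩ := Set.Infinite.exists_subset_card_eq hinf (l + 1)
    have := hSc t ht
    omega
  refine ⟨hfin.toFinset, hSc _ (by simp), ?_⟩
  rintro v w hv hw ⟨p⟩
  have e1 : ∀ᶠ W in (U : Filter (Finset V)), ∀ u ∈ p.support.toFinset, u.1 ∈ W ∧ u.1 ∉ T W := by
    refine (Filter.eventually_all_finset _).2 (fun u _ => ?_)
    refine Filter.Eventually.and ?_ ?_
    · apply hU
      filter_upwards [Filter.eventually_ge_atTop {u.1}] with W hW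
      exact hW (by simp)
    · rw [Ultrafilter.eventually_not]
      have := u.2
      simpa [S] using this
  obtain ⟨W, hW⟩ := e1.exists
  have hW' : ∀ u ∈ p.support, u.1 ∈ W ∧ u.1 ∉ T W := fun u hu => hW u (by simpa using hu)
  have key : ∀ (v w : {x : V | x ∉ hfin.toFinset}) (p : (G.induce {x : V | x ∉ hfin.toFinset}).Walk v w)
      (_ : ∀ u ∈ p.support, u.1 ∈ W ∧ u.1 ∉ T W),
      (∃ hv : v.1 ∈ (W : Set V), Rch (G.induce (W : Set V)) {v | red v.1} {v | v.1 ∈ T W} ⟨v.1, hv⟩) →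
      (∃ hv : w.1 ∈ (W : Set V), Rch (G.induce (W : Set V)) {v | red v.1} {v | v.1 ∈ T W} ⟨w.1, hv⟩) := by
    intro v w p
    induction p with
    | nil => exact fun _ h => h
    | cons hadj p ih =>
      rintro hp ⟨hv, hr⟩
      rename_i u v' w'
      have hv' := hp v' (by simp)
      exact ih (fun u hu => hp u (by simp [hu])) ⟨hv'.1, Rch.step _ _ hr hadj hv'.2⟩
  have hv0 := hW' v (by simp)
  obtain ⟨hw1, hr⟩ := key v w p hW' ⟨hv0.1, Rch.base _ hv hv0.2⟩
  exact hT W _ hw hr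
end

section
/- Let $k \ge 3$ be an integer. There exists a positive integer $N = N(k)$ such that every 2-connected graph with at least $N$ vertices contains either a cycle of length at least $k$ as a subgraph, or the complete bipartite graph $K_{2,k}$ as a minor. In fact, $N = k^{3k^2}+1$ suffices. -/
/-- `H` is a minor of `G`: there are pairwise disjoint nonempty connected branch
sets in `G`, one for each vertex of `H`, with an edge of `G` between the branch
sets of any two adjacent vertices of `H`. -/
def IsMinor {U V : Type*} (H : SimpleGraph U) (G : SimpleGraph V) : Prop :=
  ∃ B : U → Set V, (∀ u, (B u).Nonempty) ∧ (∀ u, (G.induce (B u)).Connected) ∧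
    (Pairwise fun u u' => Disjoint (B u) (B u')) ∧
    ∀ ⦃u u'⦄, H.Adj u u' → ∃ x ∈ B u, ∃ y ∈ B u', G.Adj x y

/-- A graph is 2-connected: at least 3 vertices, connected, and no cut vertex. -/
def TwoConnected {V : Type*} [Fintype V] (G : SimpleGraph V) : Prop :=
  3 ≤ Fintype.card V ∧ G.Connected ∧
    ∀ v : V, (((⊤ : G.Subgraph).deleteVerts {v}).coe.Connected)

namespace CycleMinorAux

open SimpleGraph

variable {V : Type*} {G : SimpleGraph V}

/-- Removing any vertex leaves the rest connected, phrased with walks. -/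
def Robust (G : SimpleGraph V) : Prop :=
  ∀ v x y : V, x ≠ v → y ≠ v → ∃ p : G.Walk x y, v ∉ p.support

lemma robust_of_twoConnected [Fintype V] (h : TwoConnected G) : Robust G := by
  intro v x y hx hy
  obtain ⟨-, -, h⟩ := h
  have hc := (h v).preconnected ⟨x, by simpa using hx⟩ ⟨y, by simpa using hy⟩
  obtain ⟨p⟩ := hc
  refine ⟨p.map (Subgraph.hom _), ?_⟩
  intro hv
  have hv := List.mem_map.1 ((Walk.support_map (Subgraph.hom _) p) ▸ hv)
  obtain ⟨⟨a, ha⟩, -, hav⟩ := hv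
  simp at ha
  exact ha hav

/-- First hitting point of a set along a walk. -/
lemma first_hit (C : Set V) {a b : V} (p : G.Walk a b) (hb : b ∈ C) :
    ∃ (z : V) (r : G.Walk a z) (t : G.Walk z b), p = r.append t ∧ z ∈ C ∧
      ∀ x ∈ r.support, x ∈ C → x = z := by
  induction p with
  | nil => exact ⟨_, .nil, .nil, rfl, hb, by simp⟩
  | @cons u v w h p ih =>
    by_cases hu : u ∈ C
    · exact ⟨u, .nil, .cons h p, rfl, hu, by simp⟩
    · obtain ⟨z, r, t, rfl, hz, hr⟩ := ih hb
      refine ⟨z, .cons h r, t, rfl, hz, ?_⟩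
      intro x hx hxC
      rw [Walk.support_cons, List.mem_cons] at hx
      rcases hx with rfl | hx
      · exact absurd hxC hu
      · exact hr x hx hxC

lemma isPath_append {a b c : V} {p : G.Walk a b} {q : G.Walk b c} (hp : p.IsPath) (hq : q.IsPath)
    (h : ∀ x ∈ p.support, x ∈ q.support → x = b) : (p.append q).IsPath := by
  rw [Walk.isPath_def, Walk.support_append, List.nodup_append']
  refine ⟨hp.support_nodup, hq.support_nodup.tail, ?_⟩
  intro x hx hx'
  have := h x hx (List.mem_of_mem_tail hx')
  subst this
  have h2 := hq.support_nodup
  rw [← Walk.cons_tail_support] at h2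
  exact (List.nodup_cons.1 h2).1 hx'

lemma isCycle_append {a b : V} {p : G.Walk a b} {q : G.Walk b a} (hp : p.IsPath) (hq : q.IsPath)
    (h : ∀ x ∈ p.support, x ∈ q.support → x = a ∨ x = b) (hn : 1 < p.length ∨ 1 < q.length) :
    (p.append q).IsCycle := by
  refine hp.isCycle_append hq ?_ hn
  intro x hx hx'
  have hpn := hp.support_nodup
  rw [← Walk.cons_tail_support] at hpn
  have hqn := hq.support_nodup
  rw [← Walk.cons_tail_support] at hqn
  rcases h x (List.mem_of_mem_tail hx) (List.mem_of_mem_tail hx') with rfl | rfl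
  · exact (List.nodup_cons.1 hpn).1 hx
  · exact (List.nodup_cons.1 hqn).1 hx'

/-- Two paths from `u` to `w` meeting only at their ends (possibly equal to a single edge). -/
def Pair (G : SimpleGraph V) (u w : V) : Prop :=
  ∃ p q : G.Walk u w, p.IsPath ∧ q.IsPath ∧
    ∀ x ∈ p.support, x ∈ q.support → x = u ∨ x = w

lemma pair_step_aux {u w w' z : V} (p q : G.Walk u w) (hp : p.IsPath) (hq : q.IsPath)
    (hpq : ∀ x ∈ p.support, x ∈ q.support → x = u ∨ x = w) (hadj : G.Adj w w') (hw' : w' ≠ u)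
    (r : G.Walk w' z) (hr : r.IsPath) (hrw : w ∉ r.support) (hz : z ∈ p.support)
    (hfirst : ∀ x ∈ r.support, x ∈ p.support ∨ x ∈ q.support → x = z) : Pair G u w' := by
  classical
  have hzw : z ≠ w := by
    rintro rfl
    exact hrw r.end_mem_support
  have hw'q : w' ∉ q.support := by
    intro h
    have := hfirst w' r.start_mem_support (Or.inr h)
    subst this
    rcases hpq _ hz h with h | h
    · exact hw' h
    · exact hzw h
  have hwp : w ∉ (p.takeUntil z hz).support := by
    intro h
    have h1 : ((p.takeUntil z hz).append (p.dropUntil z hz)).IsPath := by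
      rwa [Walk.take_spec]
    exact (h1.ne_of_mem_support_of_append (Ne.symm hzw) h (Walk.end_mem_support _)) rfl
  have hsub : ∀ x ∈ (p.takeUntil z hz).support, x ∈ p.support := fun x hx =>
    p.support_takeUntil_subset_support hz hx
  refine ⟨(p.takeUntil z hz).append r.reverse, q.concat hadj, ?_, hq.concat hw'q hadj, ?_⟩
  · refine isPath_append (hp.takeUntil hz) hr.reverse ?_
    intro x hx hx'
    rw [Walk.support_reverse, List.mem_reverse] at hx'
    exact hfirst x hx' (Or.inl (hsub x hx))
  · intro x hx hx'
    rw [Walk.mem_support_append_iff, Walk.support_reverse, List.mem_reverse] at hx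
    rw [Walk.support_concat, List.mem_append, List.mem_singleton] at hx'
    rcases hx' with hx' | hx'
    · left
      have key : ∀ y ∈ p.support, y ∈ q.support → y ≠ w → y = u := fun y h1 h2 h3 =>
        (hpq y h1 h2).resolve_right h3
      rcases hx with hx | hx
      · exact key x (hsub x hx) hx' (fun h => hwp (h ▸ hx))
      · have := hfirst x hx (Or.inr hx')
        subst this
        exact key x hz hx' hzw
    · exact Or.inr hx'

lemma pair_step (hG : Robust G) {u w w' : V} (huw : u ≠ w) (h : Pair G u w) (hadj : G.Adj w w')
    (hw' : w' ≠ u) : Pair G u w' := by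
  classical
  obtain ⟨p, q, hp, hq, hpq⟩ := h
  obtain ⟨s, hs⟩ := hG w w' u hadj.ne' huw
  obtain ⟨z, r, t, hrt, hz, hr⟩ := first_hit {x | x ∈ p.support ∨ x ∈ q.support} s.bypass
    (Or.inl p.start_mem_support)
  have hpath : r.IsPath := by
    have := s.bypass_isPath
    rw [hrt] at this
    exact this.of_append_left
  have hwr : w ∉ r.support := by
    intro h
    apply hs
    apply s.support_bypass_subset_support
    rw [hrt]
    exact Walk.support_subset_support_append_left _ _ h
  rcases hz with hz | hz
  · exact pair_step_aux p q hp hq hpq hadj hw' r hpath hwr hz hr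
  · exact pair_step_aux q p hq hp (fun x h1 h2 => hpq x h2 h1) hadj hw' r hpath hwr hz
      (fun x h1 h2 => hr x h1 h2.symm)

lemma pair_walk (hG : Robust G) {u a b : V} (p : G.Walk a b) (hu : u ∉ p.support)
    (h : Pair G u a) : Pair G u b := by
  induction p with
  | nil => exact h
  | @cons x y z hadj p ih =>
    rw [Walk.support_cons, List.mem_cons, not_or] at hu
    refine ih hu.2 (pair_step hG hu.1 h hadj ?_)
    rintro rfl
    exact hu.2 p.start_mem_support

lemma pair_of_path (hG : Robust G) {u b : V} (p : G.Walk u b) (hp : p.IsPath)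
    (hub : u ≠ b) : Pair G u b := by
  cases p with
  | nil => exact absurd rfl hub
  | @cons _ y _ hadj p =>
    rw [Walk.cons_isPath_iff] at hp
    refine pair_walk hG p hp.2 ⟨hadj.toWalk, hadj.toWalk, ?_, ?_, ?_⟩
    · simpa [Walk.cons_isPath_iff] using hadj.ne
    · simpa [Walk.cons_isPath_iff] using hadj.ne
    · simp

/-- A path between points of a small set `C` has a long ear of `C`. -/
lemma long_ear [DecidableEq V] (C : Finset V) (m : ℕ) (n : ℕ) :
    ∀ {a b : V} (p : G.Walk a b), p.length = n → p.IsPath → a ∈ C → b ∈ C →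
    (∃ (x y : V) (r : G.Walk x y), r.IsPath ∧ x ∈ C ∧ y ∈ C ∧ x ≠ y ∧ m < r.length ∧
      ∀ z ∈ r.support, z ∈ C → z = x ∨ z = y) ∨
    p.length + m ≤ m * (C.filter (· ∈ p.support)).card := by
  induction n using Nat.strong_induction_on with
  | _ n ih =>
  intro a b p hn hp ha hb
  cases p with
  | nil =>
    right
    have : (C.filter (· ∈ (Walk.nil : G.Walk a a).support)) = {a} := by
      ext x; simp; rintro rfl; exact ha
    rw [this]; simp
  | @cons _ y _ hadj p =>
    obtain ⟨z, r, t, rfl, hz, hr⟩ := first_hit (C : Set V) p hb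
    have hp' := hp
    rw [Walk.cons_isPath_iff] at hp
    have har : a ∉ r.support := fun h =>
      hp.2 (Walk.support_subset_support_append_left _ _ h)
    have hat : a ∉ t.support := fun h =>
      hp.2 (Walk.support_subset_support_append_right _ _ h)
    by_cases hm : m < r.length + 1
    · left
      refine ⟨a, z, .cons hadj r, ?_, ha, hz, ?_, by simpa using hm, ?_⟩
      · rw [Walk.cons_isPath_iff]
        exact ⟨hp.1.of_append_left, har⟩
      · rintro rfl
        exact har r.end_mem_support
      · intro x hx hxC
        rw [Walk.support_cons, List.mem_cons] at hx
        rcases hx with hx | hx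
        · exact Or.inl hx
        · exact Or.inr (hr x hx hxC)
    · have hlen : (Walk.cons hadj (r.append t)).length = r.length + t.length + 1 := by
        simp
      rcases ih t.length (by omega) t rfl hp.1.of_append_right hz hb with h | h
      · exact Or.inl h
      · right
        have hcard : (C.filter (· ∈ t.support)).card + 1 ≤
            (C.filter (· ∈ (Walk.cons hadj (r.append t)).support)).card := by
          rw [← Finset.card_insert_of_notMem (a := a) (s := C.filter (· ∈ t.support))
            (by simp [hat])]
          apply Finset.card_le_card
          intro x hx
          rw [Finset.mem_insert, Finset.mem_filter] at hx
          rw [Finset.mem_filter]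
          rcases hx with rfl | hx
          · exact ⟨ha, Walk.start_mem_support _⟩
          · refine ⟨hx.1, ?_⟩
            rw [Walk.support_cons, List.mem_cons]
            exact Or.inr (Walk.support_subset_support_append_right _ _ hx.2)
        have := Nat.mul_le_mul_left m hcard
        rw [Nat.mul_add] at this
        omega

lemma long_cycle (hG : Robust G) (k : ℕ) (hk : 3 ≤ k) {a b : V} (P : G.Walk a b)
    (hP : P.IsPath) (hlen : 3 * k ^ 2 < P.length) :
    ∃ (v : V) (c : G.Walk v v), c.IsCycle ∧ k ≤ c.length := by
  classical
  have hab : a ≠ b := by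
    rintro rfl
    have : P = .nil := (Walk.isPath_iff_nil.1 hP).eq_nil
    rw [this] at hlen
    simp at hlen
  obtain ⟨p, q, hp, hq, hpq⟩ := pair_of_path hG P hP hab
  set C : Finset V := p.support.toFinset ∪ q.support.toFinset with hC
  have hmem : ∀ x, x ∈ C ↔ x ∈ p.support ∨ x ∈ q.support := by
    intro x; simp [hC]
  by_cases hcard : k ≤ C.card
  · -- the two paths form a long cycle
    have h1 : C ⊆ (p.append q.reverse).support.tail.toFinset := by
      intro x hx
      rw [List.mem_toFinset]
      have hx' : x ∈ (p.append q.reverse).support := by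
        rw [Walk.mem_support_append_iff, Walk.support_reverse, List.mem_reverse]
        exact (hmem x).1 hx
      rw [← Walk.cons_tail_support, List.mem_cons] at hx'
      rcases hx' with rfl | hx'
      · rw [Walk.mem_tail_support_append_iff]
        right
        exact Walk.end_mem_tail_support_of_ne hab.symm _
      · exact hx'
    have h2 : k ≤ (p.append q.reverse).length := by
      calc k ≤ C.card := hcard
        _ ≤ _ := Finset.card_le_card h1
        _ ≤ _ := List.toFinset_card_le _
        _ = _ := by simp
    refine ⟨a, p.append q.reverse, ?_, h2⟩
    refine isCycle_append hp hq.reverse ?_ ?_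
    · intro x hx hx'
      rw [Walk.support_reverse, List.mem_reverse] at hx'
      exact hpq x hx hx'
    · rw [Walk.length_append] at h2
      omega
  · have haC : a ∈ C := (hmem a).2 (Or.inl p.start_mem_support)
    have hbC : b ∈ C := (hmem b).2 (Or.inl p.end_mem_support)
    rcases long_ear C k _ P rfl hP haC hbC with h | h
    · obtain ⟨x, y, r, hr, hx, hy, hxy, hm, hrC⟩ := h
      -- a walk inside C back to the start
      have hto : ∀ x ∈ C, ∃ s : G.Walk a x, ∀ z ∈ s.support, z ∈ C := by
        intro x hx
        rcases (hmem x).1 hx with h | h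
        · exact ⟨p.takeUntil x h, fun z hz =>
            (hmem z).2 (Or.inl (p.support_takeUntil_subset_support h hz))⟩
        · exact ⟨q.takeUntil x h, fun z hz =>
            (hmem z).2 (Or.inr (q.support_takeUntil_subset_support h hz))⟩
      obtain ⟨s1, hs1⟩ := hto x hx
      obtain ⟨s2, hs2⟩ := hto y hy
      refine ⟨x, r.append (s2.reverse.append s1).bypass, ?_, ?_⟩
      · refine isCycle_append hr (Walk.bypass_isPath _) ?_ (Or.inl (by omega))
        intro z hz hz'
        refine hrC z hz ?_
        have := Walk.support_bypass_subset_support _ hz'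
        rw [Walk.mem_support_append_iff, Walk.support_reverse, List.mem_reverse] at this
        rcases this with h | h
        · exact hs2 z h
        · exact hs1 z h
      · rw [Walk.length_append]
        omega
    · exfalso
      have h3 : (C.filter (· ∈ P.support)).card ≤ k :=
        (Finset.card_filter_le _ _).trans (by omega)
      have := Nat.mul_le_mul_left k h3
      nlinarith

lemma minor_of_components (k : ℕ) {S : Set V} {w : V} {Q : Set V} (hw : w ∉ S) (hwQ : w ∉ Q)
    (hQ : (G.induce Q).Connected) (hSQ : Disjoint S Q)
    (D : Fin k → Set V) (hD : ∀ i, (G.induce (D i)).Connected) (hDS : ∀ i, D i ⊆ S)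
    (hdisj : Pairwise fun i j => Disjoint (D i) (D j))
    (h1 : ∀ i, ∃ x ∈ D i, G.Adj x w) (h2 : ∀ i, ∃ x ∈ D i, ∃ y ∈ Q, G.Adj x y) :
    IsMinor (completeBipartiteGraph (Fin 2) (Fin k)) G := by
  have hDw : ∀ i, Disjoint {w} (D i) := fun i => by
    rw [Set.disjoint_singleton_left]; exact fun h => hw (hDS i h)
  have hDQ : ∀ i, Disjoint Q (D i) := fun i => (hSQ.mono_left (hDS i)).symm
  have hwQ' : Disjoint {w} Q := by rwa [Set.disjoint_singleton_left]
  have hconn : ∀ u : Fin 2 ⊕ Fin k,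
      (G.induce ((Sum.elim (fun j : Fin 2 => if j = 0 then {w} else Q) D) u)).Connected := by
    rintro (j | i)
    · fin_cases j
      · simp only [Sum.elim_inl]
        have := (Walk.nil : G.Walk w w).connected_induce_support
        simpa using this
      · simpa using hQ
    · exact hD i
  refine ⟨Sum.elim (fun j => if j = 0 then {w} else Q) D, ?_, hconn, ?_, ?_⟩
  · intro u
    obtain ⟨x⟩ := (hconn u).nonempty
    exact ⟨x.1, x.2⟩
  · rintro (j | i) (j' | i') hne
    · fin_cases j <;> fin_cases j' <;> simp_all
    · fin_cases j
      · exact hDw i'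
      · exact hDQ i'
    · fin_cases j'
      · exact (hDw i).symm
      · exact (hDQ i).symm
    · exact hdisj (fun h => hne (by rw [h]))
  · have key : ∀ (j : Fin 2) (i : Fin k), ∃ x ∈ D i,
        ∃ y ∈ (if j = 0 then {w} else Q : Set V), G.Adj x y := by
      intro j i
      fin_cases j
      · obtain ⟨x, hx, hxw⟩ := h1 i
        exact ⟨x, hx, w, rfl, hxw⟩
      · exact h2 i
    rintro (j | i) (j' | i') hadj
    · simp at hadj
    · obtain ⟨x, hx, y, hy, h⟩ := key j i'
      exact ⟨y, hy, x, hx, h.symm⟩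
    · exact key j' i
    · simp at hadj

lemma main_bound [Finite V] (hG : Robust G) (k : ℕ) (hk : 3 ≤ k) (M : ℕ)
    (hM : ∀ (a b : V) (P : G.Walk a b), P.IsPath → P.length ≤ M)
    (hminor : ¬ IsMinor (completeBipartiteGraph (Fin 2) (Fin k)) G) (j : ℕ) :
    ∀ (v r : V) (P : G.Walk v r) (C : Set V), P.IsPath → (G.induce C).Connected →
      (∀ x ∈ C, x ∉ P.support) → (∃ c ∈ C, G.Adj c v) →
      (∀ c ∈ C, ∀ x, x ∉ C → G.Adj c x → x ∈ P.support) → P.length + j = M →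
      C.ncard + 1 ≤ k ^ j := by
  classical
  induction j with
  | zero =>
    rintro v r P C hP - hCP ⟨c, hc, hcv⟩ - hlen
    have := hM _ _ (Walk.cons hcv P) (by
      rw [Walk.cons_isPath_iff]; exact ⟨hP, hCP c hc⟩)
    rw [Walk.length_cons] at this
    omega
  | succ j ih =>
    rintro v r P C hP hconn hCP ⟨w, hwC, hwv⟩ hnb hlen
    set S : Set V := C \ {w} with hS
    have hP' : (Walk.cons hwv P).IsPath := by
      rw [Walk.cons_isPath_iff]; exact ⟨hP, hCP w hwC⟩
    let D : (G.induce S).ConnectedComponent → Set V := fun K => Subtype.val '' K.supp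
    have hDS : ∀ K, D K ⊆ S := by
      rintro K _ ⟨x, -, rfl⟩
      exact x.2
    have hDconn : ∀ K, (G.induce (D K)).Connected := by
      intro K
      refine K.connected_toSimpleGraph.map
        (H := G.induce (D K)) ⟨fun x => ⟨x.1.1, ⟨x.1, x.2, rfl⟩⟩, ?_⟩ ?_
      · intro a b hab
        exact hab
      · rintro ⟨_, ⟨x, hx, rfl⟩⟩
        exact ⟨⟨x, hx⟩, rfl⟩
    have hDdisj : Pairwise fun K K' => Disjoint (D K) (D K') := by
      intro K K' hne
      rw [Set.disjoint_left]
      rintro _ ⟨x, hx, rfl⟩ ⟨y, hy, hxy⟩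
      have : y = x := Subtype.ext hxy
      subst this
      rw [ConnectedComponent.mem_supp_iff] at hx hy
      exact hne (hx.symm.trans hy)
    -- components are closed under adjacency in S
    have hDcl : ∀ K, ∀ x ∈ D K, ∀ y ∈ S, G.Adj x y → y ∈ D K := by
      rintro K _ ⟨x, hx, rfl⟩ y hy hxy
      refine ⟨⟨y, hy⟩, ?_, rfl⟩
      rw [ConnectedComponent.mem_supp_iff] at hx ⊢
      rw [← hx]
      exact ConnectedComponent.sound (Adj.reachable (G := G.induce S) hxy.symm)
    have hDne : ∀ K, ∃ d, d ∈ D K := by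
      intro K
      obtain ⟨x⟩ := (hDconn K).nonempty
      exact ⟨x.1, x.2⟩
    have hDw : ∀ K, ∃ x ∈ D K, G.Adj x w := by
      intro K
      obtain ⟨d, hd⟩ := hDne K
      obtain ⟨p⟩ := hconn.preconnected ⟨d, (hDS K hd).1⟩ ⟨w, hwC⟩
      obtain ⟨e, -, he1, he2⟩ := p.exists_boundary_dart {x | x.1 ∈ D K} hd
        (fun h => (hDS K h).2 rfl)
      have hadj : G.Adj e.fst.1 e.snd.1 := e.adj
      refine ⟨e.fst.1, he1, ?_⟩
      by_cases hew : e.snd.1 = w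
      · rwa [← hew]
      · exact absurd (hDcl K _ he1 _ ⟨e.snd.2, hew⟩ hadj) he2
    have hDP : ∀ K, ∃ x ∈ D K, ∃ y ∈ {y | y ∈ P.support}, G.Adj x y := by
      intro K
      obtain ⟨d, hd⟩ := hDne K
      obtain ⟨p, hp⟩ := hG w d v (hDS K hd).2 hwv.ne'
      obtain ⟨e, hep, he1, he2⟩ := p.exists_boundary_dart (D K) hd
        (fun h => hCP v (hDS K h).1 P.start_mem_support)
      have hadj : G.Adj e.fst e.snd := e.adj
      refine ⟨e.fst, he1, e.snd, ?_, hadj⟩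
      have hew : e.snd ≠ w := by
        intro h
        exact hp (h ▸ p.dart_snd_mem_support_of_mem_darts hep)
      by_cases heC : e.snd ∈ C
      · exact absurd (hDcl K _ he1 _ ⟨heC, hew⟩ hadj) he2
      · exact hnb _ (hDS K he1).1 _ heC hadj
    have := Fintype.ofFinite (G.induce S).ConnectedComponent
    have hnum : Fintype.card (G.induce S).ConnectedComponent ≤ k - 1 := by
      by_contra hlt
      have hle : Fintype.card (Fin k) ≤ Fintype.card (G.induce S).ConnectedComponent := by
        rw [Fintype.card_fin]; omega
      obtain ⟨f⟩ := Function.Embedding.nonempty_of_card_le hle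
      refine hminor (minor_of_components k (S := S) (w := w) (Q := {y | y ∈ P.support})
        (fun h => h.2 rfl) (hCP w hwC) P.connected_induce_support ?_ (fun i => D (f i))
        (fun i => hDconn _) (fun i => hDS _) ?_ (fun i => hDw _) (fun i => hDP _))
      · rw [Set.disjoint_left]
        exact fun x hx => hCP x hx.1
      · intro i i' hne
        exact hDdisj (fun h => hne (f.injective h))
    have hDcard : ∀ K, (D K).ncard ≤ k ^ j - 1 := by
      intro K
      have := ih w r (Walk.cons hwv P) (D K) hP' (hDconn K) ?_ (hDw K) ?_ ?_
      · omega
      · intro x hx hx'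
        rw [Walk.support_cons, List.mem_cons] at hx'
        rcases hx' with h | h
        · exact (hDS K hx).2 h
        · exact hCP x (hDS K hx).1 h
      · intro c hc x hx hcx
        rw [Walk.support_cons, List.mem_cons]
        by_cases hxw : x = w
        · exact Or.inl hxw
        · right
          by_cases hxC : x ∈ C
          · exact absurd (hDcl K c hc x ⟨hxC, hxw⟩ hcx) hx
          · exact hnb c (hDS K hc).1 x hxC hcx
      · rw [Walk.length_cons]; omega
    have hScard : S.ncard ≤ (k - 1) * (k ^ j - 1) := by
      have hSU : S ⊆ ⋃ K, D K := by
        intro x hx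
        rw [Set.mem_iUnion]
        exact ⟨(G.induce S).connectedComponentMk ⟨x, hx⟩, ⟨x, hx⟩, rfl, rfl⟩
      calc S.ncard ≤ (⋃ K, D K).ncard := Set.ncard_le_ncard hSU (Set.toFinite _)
        _ ≤ ∑ K, (D K).ncard := Set.ncard_iUnion_le_of_fintype _
        _ ≤ ∑ _K : (G.induce S).ConnectedComponent, (k ^ j - 1) :=
          Finset.sum_le_sum fun K _ => hDcard K
        _ = Fintype.card (G.induce S).ConnectedComponent * (k ^ j - 1) := by simp
        _ ≤ _ := Nat.mul_le_mul_right _ hnum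
    have hCS : C.ncard = S.ncard + 1 := by
      rw [hS, Set.ncard_sdiff_singleton_add_one hwC (Set.toFinite _)]
    have hpos : 1 ≤ k ^ j := Nat.one_le_pow _ _ (by omega)
    rw [hCS, pow_succ]
    obtain ⟨B, hB⟩ := Nat.exists_eq_add_of_le hpos
    obtain ⟨l, hl⟩ := Nat.exists_eq_add_of_le hk
    rw [hB] at hScard ⊢
    subst hl
    have e1 : 3 + l - 1 = 2 + l := by omega
    have e2 : 1 + B - 1 = B := by omega
    rw [e1, e2] at hScard
    nlinarith

end CycleMinorAux

open CycleMinorAux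
/-- Every 2-connected graph with at least `k^(3k²) + 1` vertices contains a
cycle of length at least `k` or a `K_{2,k}` minor. -/
theorem cycle_or_K2k_minor (k : ℕ) (hk : 3 ≤ k) {V : Type*} [Fintype V]
    (G : SimpleGraph V) (h2c : TwoConnected G)
    (hcard : k ^ (3 * k ^ 2) + 1 ≤ Fintype.card V) :
    (∃ (v : V) (c : G.Walk v v), c.IsCycle ∧ k ≤ c.length) ∨
      IsMinor (completeBipartiteGraph (Fin 2) (Fin k)) G := by
  classical
  by_contra hcon
  rw [not_or] at hcon
  obtain ⟨hcyc, hminor⟩ := hcon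
  have hG := robust_of_twoConnected h2c
  obtain ⟨hV3, hconn, hdel⟩ := h2c
  have hM : ∀ (a b : V) (P : G.Walk a b), P.IsPath → P.length ≤ 3 * k ^ 2 := by
    intro a b P hP
    by_contra hlt
    exact hcyc (long_cycle hG k hk P hP (by omega))
  obtain ⟨r⟩ := hconn.nonempty
  have hC : (G.induce ({r}ᶜ : Set V)).Connected := by
    refine (hdel r).map (H := G.induce ({r}ᶜ : Set V)) ⟨fun x => ⟨x.1, ?_⟩, ?_⟩ ?_
    · have := x.2
      simpa using this
    · intro a b hab
      have h' : ((⊤ : G.Subgraph).deleteVerts {r}).Adj a.1 b.1 := hab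
      exact h'.adj_sub
    · rintro ⟨x, hx⟩
      exact ⟨⟨x, by simpa using hx⟩, rfl⟩
  have hnbr : ∃ c ∈ ({r}ᶜ : Set V), G.Adj c r := by
    obtain ⟨⟨x, hx⟩⟩ := hC.nonempty
    obtain ⟨p⟩ := hconn.preconnected r x
    cases p with
    | nil => exact absurd rfl hx
    | cons h p => exact ⟨_, h.ne', h.symm⟩
  have hb := main_bound hG k hk (3 * k ^ 2) hM hminor (3 * k ^ 2) r r .nil ({r}ᶜ : Set V)
    (by simp) hC (by simp) hnbr (by simp) (by simp)
  have hcc := Set.ncard_add_ncard_compl ({r} : Set V)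
  rw [Set.ncard_singleton, Nat.card_eq_fintype_card] at hcc
  omega
end

section
/- Every proper minor-closed class of graphs $\mathcal{A}$ is small: there is a constant $c$ such that $|\mathcal{A}_n| \le c^n \, n!$ for all $n$, i.e., $\limsup_n (|\mathcal{A}_n|/n!)^{1/n} < \infty$. -/
open Nat

namespace MinorSmall
section
open scoped Classical

/-- star-like sets are connected -/
lemma connected_of_center {V : Type} (G : SimpleGraph V) (B : Set V) (a : V) (ha : a ∈ B)
    (h : ∀ x ∈ B, x = a ∨ G.Adj x a) : (G.induce B).Connected := by
  have key : ∀ x : B, (G.induce B).Reachable x ⟨a, ha⟩ := by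
    rintro ⟨x, hx⟩
    rcases h x hx with rfl | h
    · exact SimpleGraph.Reachable.refl _
    · exact SimpleGraph.Adj.reachable (by simpa using h)
  have : Nonempty B := ⟨⟨a, ha⟩⟩
  exact ⟨fun x y => (key x).trans (key y).symm⟩

lemma isMinor_trans {U V W : Type} {H : SimpleGraph U} {K : SimpleGraph V} {G : SimpleGraph W}
    (h1 : IsMinor H K) (h2 : IsMinor K G) : IsMinor H G := by
  obtain ⟨B, hBn, hBc, hBd, hBa⟩ := h1
  obtain ⟨C, hCn, hCc, hCd, hCa⟩ := h2
  refine ⟨fun u => ⋃ v ∈ B u, C v, ?_, ?_, ?_, ?_⟩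
  · intro u
    obtain ⟨v, hv⟩ := hBn u
    obtain ⟨w, hw⟩ := hCn v
    exact ⟨w, by simp only [Set.mem_iUnion]; exact ⟨v, hv, hw⟩⟩
  · intro u
    have hsub : ∀ v ∈ B u, C v ⊆ ⋃ v ∈ B u, C v := fun v hv => Set.subset_biUnion_of_mem hv
    have same : ∀ v (hv : v ∈ B u) (x y : W) (hx : x ∈ C v) (hy : y ∈ C v),
        (G.induce (⋃ v ∈ B u, C v)).Reachable ⟨x, hsub v hv hx⟩ ⟨y, hsub v hv hy⟩ := by
      intro v hv x y hx hy
      have := (hCc v).preconnected ⟨x, hx⟩ ⟨y, hy⟩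
      exact this.map (SimpleGraph.induceHomOfLE G (hsub v hv)).toHom
    have main : ∀ (v v' : B u), (K.induce (B u)).Walk v v' → ∀ (x y : W) (hx : x ∈ C v) (hy : y ∈ C v'),
        (G.induce (⋃ v ∈ B u, C v)).Reachable ⟨x, hsub v v.2 hx⟩ ⟨y, hsub v' v'.2 hy⟩ := by
      intro v v' p
      induction p with
      | nil => intro x y hx hy; exact same _ (Subtype.prop _) x y hx hy
      | @cons a b c hab p ih =>
        intro x y hx hy
        obtain ⟨z, hz, w, hw, hzw⟩ := hCa (by simpa using hab : K.Adj a b)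
        have h1 := same _ a.2 x z hx hz
        have h2 := ih w y hw hy
        have h3 : (G.induce (⋃ v ∈ B u, C v)).Adj ⟨z, hsub a a.2 hz⟩ ⟨w, hsub b b.2 hw⟩ := by
          simpa using hzw
        exact h1.trans (h3.reachable.trans h2)
    obtain ⟨v, hv⟩ := hBn u
    obtain ⟨w, hw⟩ := hCn v
    have : Nonempty (⋃ v ∈ B u, C v : Set W) := ⟨⟨w, hsub v hv hw⟩⟩
    refine ⟨?_⟩
    rintro ⟨x, hx⟩ ⟨y, hy⟩
    have hx' := hx
    have hy' := hy
    simp only [Set.mem_iUnion] at hx' hy'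
    obtain ⟨a, ha, hxa⟩ := hx'
    obtain ⟨b, hb, hyb⟩ := hy'
    obtain ⟨p⟩ := (hBc u).preconnected ⟨a, ha⟩ ⟨b, hb⟩
    exact main _ _ p x y hxa hyb
  · intro u u' huu
    rw [Set.disjoint_left]
    intro x hx hx'
    simp only [Set.mem_iUnion] at hx hx'
    obtain ⟨a, ha, hxa⟩ := hx
    obtain ⟨b, hb, hxb⟩ := hx'
    have hab : a ≠ b := by
      rintro rfl
      exact Set.disjoint_left.1 (hBd huu) ha hb
    exact Set.disjoint_left.1 (hCd hab) hxa hxb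
  · intro u u' h
    obtain ⟨a, ha, b, hb, hab⟩ := hBa h
    obtain ⟨x, hx, y, hy, hxy⟩ := hCa hab
    exact ⟨x, Set.mem_biUnion ha hx, y, Set.mem_biUnion hb hy, hxy⟩
/-- minors through singletons -/
lemma isMinor_of_inj {V W : Type} (H : SimpleGraph W) (G : SimpleGraph V) (s : W → V)
    (hs : Function.Injective s) (h : ∀ a b, H.Adj a b → G.Adj (s a) (s b)) : IsMinor H G := by
  refine ⟨fun a => {s a}, fun a => ⟨_, rfl⟩, fun a => ?_, ?_, ?_⟩
  · exact connected_of_center G _ (s a) rfl (fun x hx => Or.inl hx)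
  · intro a b hab
    simpa using fun h => hab (hs h)
  · intro a b hab
    exact ⟨_, rfl, _, rfl, h a b hab⟩

/-- quotient graph -/
def Q {V W : Type} (f : V → W) (G : SimpleGraph V) : SimpleGraph W where
  Adj a b := a ≠ b ∧ ∃ x y, f x = a ∧ f y = b ∧ G.Adj x y
  symm := ⟨by
    rintro a b ⟨h, x, y, hx, hy, hxy⟩
    exact ⟨h.symm, y, x, hy, hx, hxy.symm⟩⟩
  loopless := ⟨by rintro a ⟨h, -⟩; exact h rfl⟩

lemma isMinor_Q {V W : Type} (f : V → W) (hf : Function.Surjective f) (G : SimpleGraph V)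
    (h : ∀ x y, f x = f y → x = y ∨ G.Adj x y) : IsMinor (Q f G) G := by
  refine ⟨fun a => f ⁻¹' {a}, fun a => ?_, fun a => ?_, ?_, ?_⟩
  · obtain ⟨x, hx⟩ := hf a
    exact ⟨x, hx⟩
  · obtain ⟨x, hx⟩ := hf a
    refine connected_of_center G _ x hx (fun y hy => h y x ?_)
    rw [hx]; exact hy
  · intro a b hab
    rw [Set.disjoint_left]
    intro x hx hx'
    exact hab (hx.symm.trans hx')
  · rintro a b ⟨-, x, y, hx, hy, hxy⟩
    exact ⟨x, hx, y, hy, hxy⟩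

lemma isMinor_Q_section {V W : Type} (f : V → W) (s : W → V) (hs : ∀ a, f (s a) = a)
    (G : SimpleGraph V)
    (h : ∀ x y, G.Adj x y → f x ≠ f y → G.Adj (s (f x)) (s (f y))) : IsMinor (Q f G) G := by
  refine isMinor_of_inj _ _ s (fun a b hab => by rw [← hs a, hab, hs b]) ?_
  rintro a b ⟨hab, x, y, rfl, rfl, hxy⟩
  exact h x y hxy hab

lemma isMinor_Q_equiv {V W X : Type} (f : V → W) (e : W ≃ X) (G : SimpleGraph V) :
    IsMinor (Q (e ∘ f) G) (Q f G) := by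
  refine isMinor_of_inj _ _ e.symm e.symm.injective ?_
  rintro a b ⟨hab, x, y, rfl, rfl, hxy⟩
  exact ⟨by simpa using hab, x, y, by simp, by simp, hxy⟩

/-- Having no `K_t` minor. -/
def Free (t : ℕ) {V : Type} (G : SimpleGraph V) : Prop := ¬ IsMinor (⊤ : SimpleGraph (Fin t)) G

lemma Free.minor {t : ℕ} {V W : Type} {G : SimpleGraph V} {H : SimpleGraph W} (hG : Free t G)
    (h : IsMinor H G) : Free t H := fun h' => hG (isMinor_trans h' h)

/-- adjacent ordered pairs -/
noncomputable def pairs {V : Type} [Fintype V] (G : SimpleGraph V) : Finset (V × V) :=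
  Finset.univ.filter (fun p => G.Adj p.1 p.2)

lemma mem_pairs {V : Type} [Fintype V] (G : SimpleGraph V) (p : V × V) :
    p ∈ pairs G ↔ G.Adj p.1 p.2 := by simp [pairs]

noncomputable def nbr {V : Type} [Fintype V] (G : SimpleGraph V) (v : V) : Finset V :=
  Finset.univ.filter (fun w => G.Adj v w)

lemma mem_nbr {V : Type} [Fintype V] (G : SimpleGraph V) (v w : V) :
    w ∈ nbr G v ↔ G.Adj v w := by simp [nbr]

lemma card_pairs {V : Type} [Fintype V] (G : SimpleGraph V) :
    (pairs G).card = ∑ v, (nbr G v).card := by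
  rw [Finset.card_eq_sum_card_fiberwise (f := Prod.fst) (t := Finset.univ) (fun _ _ => Finset.mem_coe.2 (Finset.mem_univ _))]
  refine Finset.sum_congr rfl (fun v _ => ?_)
  refine Finset.card_bij' (fun p _ => p.2) (fun w _ => (v, w)) ?_ ?_ ?_ ?_
  · rintro ⟨a, b⟩ h; simp only [Finset.mem_filter, mem_pairs, mem_nbr] at *; grind
  · intro w h; simp only [Finset.mem_filter, mem_pairs, mem_nbr] at *; grind
  · rintro ⟨a, b⟩ h; simp only [Finset.mem_filter, mem_pairs] at *; grind
  · intro w h; rfl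

lemma contract_count {V : Type} [Fintype V] (G : SimpleGraph V) (x y : V) (hxy : G.Adj x y)
    (f : V → {v // v ≠ y}) (hf : ∀ v, (f v : V) = if v = y then x else v) :
    (pairs G).card ≤ (pairs (Q f G)).card + 2 + 2 * (nbr G x ∩ nbr G y).card := by
  set C := nbr G x ∩ nbr G y with hC
  set bad : Finset (V × V) := {(x, y), (y, x)} ∪ (C.image (fun c => (y, c)) ∪ C.image (fun c => (c, y)))
    with hbad
  have hb : bad.card ≤ 2 + 2 * C.card := by
    have h1 := Finset.card_union_le {(x, y), (y, x)} (C.image (fun c => (y, c)) ∪ C.image (fun c => (c, y)))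
    have h2 := Finset.card_union_le (C.image (fun c => (y, c))) (C.image (fun c => (c, y)))
    have h3 := Finset.card_image_le (s := C) (f := fun c => (y, c))
    have h4 := Finset.card_image_le (s := C) (f := fun c => (c, y))
    have h5 := Finset.card_le_two (a := (x, y)) (b := (y, x))
    rw [hbad]
    omega
  have hmem : ∀ p : V × V, p ∈ bad ↔ p = (x, y) ∨ p = (y, x) ∨ (p.1 = y ∧ G.Adj x p.2 ∧ G.Adj y p.2) ∨
      (p.2 = y ∧ G.Adj x p.1 ∧ G.Adj y p.1) := by
    rintro ⟨a, b⟩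
    simp only [hbad, hC, Finset.mem_union, Finset.mem_insert, Finset.mem_singleton, Finset.mem_image,
      Finset.mem_inter, mem_nbr, Prod.mk.injEq]
    grind
  have h1 : (pairs G \ bad).card ≤ (pairs (Q f G)).card := by
    refine Finset.card_le_card_of_injOn (fun p => (f p.1, f p.2)) ?_ ?_
    · rintro ⟨a, b⟩ h
      simp only [Finset.coe_sdiff, Set.mem_sdiff, Finset.mem_coe, mem_pairs, hmem] at h ⊢
      refine ⟨?_, a, b, rfl, rfl, h.1⟩
      intro hab
      have := congrArg Subtype.val hab
      rw [hf, hf] at this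
      have := h.1.ne
      grind
    · rintro ⟨a, b⟩ h ⟨a', b'⟩ h' heq
      simp only [Finset.coe_sdiff, Set.mem_sdiff, Finset.mem_coe, mem_pairs, hmem] at h h'
      simp only [Prod.mk.injEq] at heq
      have e1 := congrArg Subtype.val heq.1
      have e2 := congrArg Subtype.val heq.2
      rw [hf, hf] at e1 e2
      have s1 := h.1.symm
      have s2 := h'.1.symm
      have := h.1.ne
      have := h'.1.ne
      have := hxy.ne
      have := hxy.symm
      by_cases a = y <;> by_cases b = y <;> by_cases a' = y <;> by_cases b' = y <;> grind
  have h2 := Finset.card_le_card_sdiff_add_card (s := pairs G) (t := bad)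
  omega

lemma cone_minor {t : ℕ} {V : Type} (G : SimpleGraph V) (v : V)
    (h : IsMinor (⊤ : SimpleGraph (Fin t)) (G.induce {w | G.Adj v w})) :
    IsMinor (⊤ : SimpleGraph (Fin (t+1))) G := by
  obtain ⟨B, hBn, hBc, hBd, hBa⟩ := h
  have hadj : ∀ i, ∀ x ∈ (Subtype.val '' (B i) : Set V), G.Adj v x := by
    rintro i _ ⟨x, -, rfl⟩
    exact x.2
  have hdis : ∀ i, Disjoint ({v} : Set V) (Subtype.val '' (B i)) := by
    intro i
    rw [Set.disjoint_left]
    rintro _ rfl hx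
    exact (hadj i _ hx).ne rfl
  refine ⟨fun i => Fin.cases {v} (fun i => Subtype.val '' (B i)) i, ?_, ?_, ?_, ?_⟩
  · intro i
    refine Fin.cases ?_ (fun i => ?_) i
    · exact ⟨v, rfl⟩
    · exact (hBn i).image _
  · intro i
    refine Fin.cases ?_ (fun i => ?_) i
    · exact connected_of_center G _ v rfl (fun x hx => Or.inl hx)
    · show (G.induce (Subtype.val '' (B i))).Connected
      let ph : (G.induce {w | G.Adj v w}).induce (B i) →g G.induce (Subtype.val '' (B i)) :=
        { toFun := fun x => ⟨x.1.1, x.1, x.2, rfl⟩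
          map_rel' := by intro a b h; simpa using h }
      obtain ⟨w, hw⟩ := hBn i
      have : Nonempty (Subtype.val '' (B i) : Set V) := ⟨⟨w.1, w, hw, rfl⟩⟩
      refine ⟨?_⟩
      rintro ⟨_, x, hx, rfl⟩ ⟨_, y, hy, rfl⟩
      exact ((hBc i).preconnected ⟨x, hx⟩ ⟨y, hy⟩).map ph
  · intro i j
    refine Fin.cases ?_ (fun i => ?_) i <;> refine Fin.cases ?_ (fun j => ?_) j
    · intro h; exact absurd rfl h
    · intro _; exact hdis j
    · intro _; exact (hdis i).symm
    · intro h
      have hij : i ≠ j := fun e => h (by rw [e])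
      exact (Set.disjoint_image_iff Subtype.val_injective).2 (hBd hij)
  · intro i j
    refine Fin.cases ?_ (fun i => ?_) i <;> refine Fin.cases ?_ (fun j => ?_) j
    · intro h; exact absurd rfl h.ne
    · intro _
      obtain ⟨w, hw⟩ := hBn j
      exact ⟨v, rfl, w, ⟨w, hw, rfl⟩, w.2⟩
    · intro _
      obtain ⟨w, hw⟩ := hBn i
      exact ⟨w, ⟨w, hw, rfl⟩, v, rfl, SimpleGraph.Adj.symm w.2⟩
    · intro h
      have hij : i ≠ j := fun e => h.ne (by rw [e])
      obtain ⟨x, hx, y, hy, hxy⟩ := hBa (show (⊤ : SimpleGraph (Fin t)).Adj i j from hij)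
      exact ⟨x, ⟨x, hx, rfl⟩, y, ⟨y, hy, rfl⟩, hxy⟩

lemma mader (t : ℕ) : ∃ D : ℕ, ∀ (V : Type) [Fintype V] (G : SimpleGraph V), Free t G →
    (pairs G).card ≤ D * Fintype.card V := by
  induction t with
  | zero =>
    refine ⟨0, fun V _ G h => ?_⟩
    exact absurd ⟨fun u => u.elim0, fun u => u.elim0, fun u => u.elim0, fun u => u.elim0,
      fun u => u.elim0⟩ h
  | succ t ih =>
    obtain ⟨D, hD⟩ := ih
    refine ⟨2 * D + 2, ?_⟩
    suffices H : ∀ n : ℕ, ∀ (V : Type) [Fintype V] (G : SimpleGraph V), Fintype.card V = n →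
        Free (t+1) G → (pairs G).card ≤ (2 * D + 2) * n from
      fun V _ G h => H _ V G rfl h
    intro n
    induction n with
    | zero =>
      intro V _ G hn _
      have := Fintype.card_eq_zero_iff.1 hn
      simp [Finset.eq_empty_of_isEmpty]
    | succ n ihn =>
      intro V _ G hn hG
      by_cases hex : ∃ x y, G.Adj x y ∧ (nbr G x ∩ nbr G y).card ≤ D
      · obtain ⟨x, y, hxy, hc⟩ := hex
        let f : V → {v // v ≠ y} := fun v => if h : v = y then ⟨x, hxy.ne⟩ else ⟨v, h⟩
        have hf : ∀ v, (f v : V) = if v = y then x else v := by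
          intro v; by_cases h : v = y <;> simp [f, h]
        have h1 := contract_count G x y hxy f hf
        have hfree : Free (t+1) (Q f G) := by
          refine hG.minor (isMinor_Q f ?_ G ?_)
          · rintro ⟨v, hv⟩
            exact ⟨v, Subtype.ext (by rw [hf]; simp [hv])⟩
          · intro a b hab
            have := congrArg Subtype.val hab
            rw [hf, hf] at this
            have := hxy.symm
            grind
        have h2 := ihn {v // v ≠ y} (Q f G) (by
          rw [Fintype.card_subtype_compl, hn]; simp) hfree
        have : (2 * D + 2) * (n+1) = (2 * D + 2) * n + 2 + 2 * D := by ring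
        omega
      · push Not at hex
        by_contra hlt
        have hpos : 0 < (pairs G).card := by omega
        obtain ⟨⟨v, w⟩, hvw⟩ := Finset.card_pos.1 hpos
        rw [mem_pairs] at hvw
        have hfree : Free t (G.induce {w | G.Adj v w}) := fun h => hG (cone_minor G v h)
        have h1 := hD _ _ hfree
        rw [card_pairs] at h1
        have h2 : ∀ a : {w | G.Adj v w}, D + 1 ≤ (nbr (G.induce {w | G.Adj v w}) a).card := by
          rintro ⟨a, ha⟩
          refine (hex v a ha).trans_le ?_
          rw [← Finset.card_image_of_injective _ Subtype.val_injective]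
          refine Finset.card_le_card ?_
          intro b hb
          simp only [Finset.mem_inter, mem_nbr] at hb
          simp only [Finset.mem_image, mem_nbr]
          exact ⟨⟨b, hb.1⟩, hb.2, rfl⟩
        have h3 := Finset.sum_le_sum (fun a (_ : a ∈ Finset.univ) => h2 a)
        simp only [Finset.sum_const, Finset.card_univ, smul_eq_mul] at h3
        have : Nonempty {w | G.Adj v w} := ⟨⟨w, hvw⟩⟩
        have h4 : 0 < Fintype.card {w | G.Adj v w} := Fintype.card_pos
        nlinarith

lemma low_degree {t D : ℕ} (hD : ∀ (V : Type) [Fintype V] (G : SimpleGraph V), Free t G →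
    (pairs G).card ≤ D * Fintype.card V) {W : Type} [Fintype W] (H : SimpleGraph W)
    (hH : Free t H) (X : Finset W) (hX : X.Nonempty) : ∃ v ∈ X, (nbr H v ∩ X).card ≤ D := by
  by_contra hcon
  push Not at hcon
  have hfree : Free t (H.induce {w | w ∈ X}) :=
    hH.minor (isMinor_of_inj _ H Subtype.val Subtype.val_injective (fun a b h => h))
  have h1 := hD _ _ hfree
  rw [card_pairs] at h1
  have h2 : ∀ a : {w | w ∈ X}, D + 1 ≤ (nbr (H.induce {w | w ∈ X}) a).card := by
    rintro ⟨a, ha⟩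
    refine (Nat.succ_le_of_lt (hcon a ha)).trans ?_
    rw [← Finset.card_image_of_injective _ Subtype.val_injective]
    refine Finset.card_le_card ?_
    intro b hb
    simp only [Finset.mem_inter, mem_nbr] at hb
    simp only [Finset.mem_image, mem_nbr]
    exact ⟨⟨b, hb.2⟩, hb.1, rfl⟩
  have h3 := Finset.sum_le_sum (fun a (_ : a ∈ Finset.univ) => h2 a)
  simp only [Finset.sum_const, Finset.card_univ, smul_eq_mul] at h3
  obtain ⟨w, hw⟩ := hX
  have : Nonempty {w | w ∈ X} := ⟨⟨w, hw⟩⟩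
  have h4 : 0 < Fintype.card {w | w ∈ X} := Fintype.card_pos
  nlinarith

lemma clique_count {t D : ℕ} (hD : ∀ (V : Type) [Fintype V] (G : SimpleGraph V), Free t G →
    (pairs G).card ≤ D * Fintype.card V) {W : Type} [Fintype W] (H : SimpleGraph W)
    (hH : Free t H) : ∀ (n : ℕ) (X : Finset W), X.card = n →
    (X.powerset.filter (fun K => ∀ a ∈ K, ∀ b ∈ K, a ≠ b → H.Adj a b)).card ≤ 2 ^ D * n + 1 := by
  intro n
  induction n with
  | zero =>
    intro X hX
    rw [Finset.card_eq_zero] at hX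
    subst hX
    exact (Finset.card_filter_le _ _).trans (by simp)
  | succ n ih =>
    intro X hX
    obtain ⟨v, hv, hdeg⟩ := low_degree hD H hH X (Finset.card_pos.1 (by omega))
    have h1 := ih (X.erase v) (by rw [Finset.card_erase_of_mem hv, hX]; rfl)
    have hsub : X.powerset.filter (fun K => ∀ a ∈ K, ∀ b ∈ K, a ≠ b → H.Adj a b) ⊆
        (X.erase v).powerset.filter (fun K => ∀ a ∈ K, ∀ b ∈ K, a ≠ b → H.Adj a b) ∪
        ((nbr H v ∩ X).powerset.image (fun K => insert v K)) := by
      intro K hK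
      simp only [Finset.mem_filter, Finset.mem_powerset] at hK
      simp only [Finset.mem_union, Finset.mem_filter, Finset.mem_powerset, Finset.mem_image]
      by_cases hvK : v ∈ K
      · right
        refine ⟨K.erase v, ?_, Finset.insert_erase hvK⟩
        intro b hb
        rw [Finset.mem_erase] at hb
        rw [Finset.mem_inter, mem_nbr]
        exact ⟨hK.2 v hvK b hb.2 hb.1.symm, hK.1 hb.2⟩
      · left
        refine ⟨fun b hb => ?_, hK.2⟩
        rw [Finset.mem_erase]
        exact ⟨fun e => hvK (e ▸ hb), hK.1 hb⟩
    have h2 := (Finset.card_le_card hsub).trans (Finset.card_union_le _ _)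
    have h3 : ((nbr H v ∩ X).powerset.image (fun K => insert v K)).card ≤ 2 ^ D := by
      refine Finset.card_image_le.trans ?_
      rw [Finset.card_powerset]
      exact Nat.pow_le_pow_right (by norm_num) hdeg
    have : 2 ^ D * (n + 1) = 2 ^ D * n + 2 ^ D := by ring
    omega

lemma nbhd_count {t D : ℕ} (hD : ∀ (V : Type) [Fintype V] (G : SimpleGraph V), Free t G →
    (pairs G).card ≤ D * Fintype.card V) {V : Type} [Fintype V] (G : SimpleGraph V)
    (hG : Free t G) (B : Finset V) (hB : ∀ x y, x ∉ B → y ∉ B → ¬ G.Adj x y) :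
    ((Finset.univ \ B).image (nbr G)).card ≤ (D + 2 ^ D) * B.card + 1 := by
  have hpq : ∃ p q : Sym2 V → V, ∀ e, e = s(p e, q e) := by
    have : ∀ e : Sym2 V, ∃ p : V × V, e = s(p.1, p.2) := by
      intro e
      induction e with
      | _ a b => exact ⟨(a, b), rfl⟩
    choose g hg using this
    exact ⟨fun e => (g e).1, fun e => (g e).2, hg⟩
  obtain ⟨p, q, hpq⟩ := hpq
  let P : Finset (Sym2 V) → Prop := fun E => ∃ F : Sym2 V → V, Set.InjOn F E ∧
    ∀ e ∈ E, ¬ e.IsDiag ∧ F e ∉ B ∧ ∀ x ∈ e, G.Adj (F e) x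
  have hne : (Finset.univ.filter P).Nonempty := by
    refine ⟨∅, ?_⟩
    simp only [Finset.mem_filter, Finset.mem_univ, true_and, P]
    by_cases hV : Nonempty V
    · obtain ⟨v⟩ := hV
      exact ⟨fun _ => v, by simp, by simp⟩
    · refine ⟨fun e => absurd ⟨p e⟩ hV, by simp, by simp⟩
  obtain ⟨E, hE, hmax⟩ := Finset.exists_max_image _ Finset.card hne
  simp only [Finset.mem_filter, Finset.mem_univ, true_and] at hE hmax
  obtain ⟨F, hinj, hF⟩ := hE
  have hmB : ∀ e ∈ E, ∀ x ∈ e, x ∈ B := by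
    intro e he x hx
    by_contra hxB
    exact hB _ _ (hF e he).2.1 hxB ((hF e he).2.2 x hx)
  have hpm : ∀ e : Sym2 V, p e ∈ e := fun e =>
    (congrArg (fun z => p e ∈ z) (hpq e)).mpr (Sym2.mem_mk_left _ _)
  have hqm : ∀ e : Sym2 V, q e ∈ e := fun e =>
    (congrArg (fun z => q e ∈ z) (hpq e)).mpr (Sym2.mem_mk_right _ _)
  have hne' : ∀ e ∈ E, p e ≠ q e := by
    intro e he h
    apply (hF e he).1
    rw [hpq e, h]
    exact Sym2.mk_isDiag_iff.2 rfl
  let H : SimpleGraph {x // x ∈ B} :=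
    { Adj := fun a b => a ≠ b ∧ s(a.1, b.1) ∈ E
      symm := ⟨fun a b h => ⟨h.1.symm, by rw [Sym2.eq_swap]; exact h.2⟩⟩
      loopless := ⟨fun a h => h.1 rfl⟩ }
  have hHm : IsMinor H G := by
    refine ⟨fun a => {x | x = a.1 ∨ ∃ e ∈ E, p e = a.1 ∧ F e = x}, ?_, ?_, ?_, ?_⟩
    · intro a; exact ⟨a.1, Or.inl rfl⟩
    · intro a
      refine connected_of_center G _ a.1 (Or.inl rfl) ?_
      rintro x (hx | ⟨e, he, hpe, rfl⟩)
      · exact Or.inl hx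
      · right
        rw [← hpe]
        exact (hF e he).2.2 _ (hpm e)
    · intro a b hab
      rw [Set.disjoint_left]
      rintro x (hx | ⟨e, he, hpe, rfl⟩) (hx' | ⟨e', he', hpe', hx'⟩)
      · exact hab (Subtype.ext (hx.symm.trans hx'))
      · exact (hF e' he').2.1 (by rw [hx', hx]; exact a.2)
      · exact (hF e he).2.1 (by rw [hx']; exact b.2)
      · have := hinj he' he hx'
        subst this
        exact hab (Subtype.ext (hpe.symm.trans hpe'))
    · rintro a b ⟨hab, he⟩
      have h1 := (hF _ he).2.2 a.1 (Sym2.mem_mk_left _ _)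
      have h2 := (hF _ he).2.2 b.1 (Sym2.mem_mk_right _ _)
      rcases Sym2.mem_iff.1 (hpm s(a.1, b.1)) with h | h
      · exact ⟨_, Or.inr ⟨_, he, h, rfl⟩, b.1, Or.inl rfl, h2⟩
      · exact ⟨a.1, Or.inl rfl, _, Or.inr ⟨_, he, h, rfl⟩, h1.symm⟩
  have hHf : Free t H := hG.minor hHm
  have hEc : E.card ≤ D * B.card := by
    have h1 := hD _ H hHf
    rw [Fintype.card_coe] at h1
    refine le_trans ?_ h1
    rw [← Finset.card_attach]
    refine Finset.card_le_card_of_injOn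
      (fun e => (⟨p e.1, hmB _ e.2 _ (hpm _)⟩, ⟨q e.1, hmB _ e.2 _ (hqm _)⟩)) ?_ ?_
    · rintro ⟨e, he⟩ -
      simp only [Finset.mem_coe, mem_pairs]
      refine ⟨fun h => hne' e he (congrArg Subtype.val h), ?_⟩
      show s(p e, q e) ∈ E
      rw [← hpq]; exact he
    · rintro ⟨e, he⟩ - ⟨e', he'⟩ - h
      simp only [Prod.mk.injEq, Subtype.mk.injEq] at h
      refine Subtype.ext ?_
      show e = e'
      rw [hpq e, hpq e', h.1, h.2]
  have hcl := clique_count hD H hHf _ Finset.univ rfl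
  rw [Finset.card_univ, Fintype.card_coe] at hcl
  have hsub : (Finset.univ \ B).image (nbr G) ⊆ E.image (fun e => nbr G (F e)) ∪
      ((Finset.univ : Finset {x // x ∈ B}).powerset.filter
        (fun K => ∀ a ∈ K, ∀ b ∈ K, a ≠ b → H.Adj a b)).image (fun K => K.image Subtype.val) := by
    intro K hK
    simp only [Finset.mem_image, Finset.mem_sdiff, Finset.mem_univ, true_and] at hK
    obtain ⟨v, hv, rfl⟩ := hK
    rw [Finset.mem_union]
    by_cases hvE : ∃ e ∈ E, F e = v
    · left
      obtain ⟨e, he, rfl⟩ := hvE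
      exact Finset.mem_image_of_mem _ he
    · right
      push Not at hvE
      rw [Finset.mem_image]
      refine ⟨Finset.univ.filter (fun a => a.1 ∈ nbr G v), ?_, ?_⟩
      · simp only [Finset.mem_filter, Finset.mem_powerset, Finset.subset_univ, true_and,
          Finset.mem_univ, mem_nbr]
        intro a ha b hb hab
        refine ⟨hab, ?_⟩
        by_contra hnot
        have := hmax (insert s(a.1, b.1) E) (by
          refine ⟨Function.update F s(a.1, b.1) v, ?_, ?_⟩
          · intro e he e' he' hee
            simp only [Finset.coe_insert, Set.mem_insert_iff, Finset.mem_coe] at he he'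
            by_cases h1 : e = s(a.1, b.1) <;> by_cases h2 : e' = s(a.1, b.1)
            · rw [h1, h2]
            · subst h1
              rw [Function.update_self, Function.update_of_ne h2] at hee
              exact absurd hee.symm (hvE e' (he'.resolve_left h2))
            · subst h2
              rw [Function.update_self, Function.update_of_ne h1] at hee
              exact absurd hee (hvE e (he.resolve_left h1))
            · rw [Function.update_of_ne h1, Function.update_of_ne h2] at hee
              exact hinj (he.resolve_left h1) (he'.resolve_left h2) hee
          · intro e he
            by_cases h1 : e = s(a.1, b.1)
            · subst h1
              rw [Function.update_self]
              refine ⟨fun h => hab (Subtype.ext (Sym2.mk_isDiag_iff.1 h)), hv, ?_⟩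
              intro x hx
              rcases Sym2.mem_iff.1 hx with rfl | rfl
              · exact ha
              · exact hb
            · rw [Function.update_of_ne h1]
              exact hF e ((Finset.mem_insert.1 he).resolve_left h1))
        rw [Finset.card_insert_of_notMem hnot] at this
        omega
      · ext x
        simp only [Finset.mem_image, Finset.mem_filter, Finset.mem_univ, true_and, mem_nbr,
          Subtype.exists, exists_and_right, exists_eq_right]
        constructor
        · rintro ⟨a, h⟩; grind
        · intro h
          have : x ∈ B := by
            by_contra hx
            exact hB _ _ hv hx h
          grind
  have h1 := (Finset.card_le_card hsub).trans (Finset.card_union_le _ _)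
  have h2 := Finset.card_image_le (s := E) (f := fun e => nbr G (F e))
  have h3 := Finset.card_image_le (s := (Finset.univ : Finset {x // x ∈ B}).powerset.filter
        (fun K => ∀ a ∈ K, ∀ b ∈ K, a ≠ b → H.Adj a b)) (f := fun K => K.image Subtype.val)
  have h4 := h3.trans ((le_of_eq (by congr!)).trans hcl)
  rw [add_mul]
  omega

lemma pairing {V : Type} [Fintype V] (R : V → V → Prop) :
    ∃ (S : Finset V) (r : V → V), (∀ v ∈ S, R v (r v) ∧ r v ∉ S) ∧ Set.InjOn r S ∧
      ∀ x y, x ≠ y → x ∉ S ∪ S.image r → y ∉ S ∪ S.image r → ¬ R x y := by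
  let P : Finset V → Prop := fun S => ∃ r : V → V, (∀ v ∈ S, R v (r v) ∧ r v ∉ S) ∧ Set.InjOn r S
  have hne : (Finset.univ.filter P).Nonempty := by
    refine ⟨∅, ?_⟩
    simp only [Finset.mem_filter, Finset.mem_univ, true_and, P]
    exact ⟨id, by simp, by simp⟩
  obtain ⟨S, hS, hmax⟩ := Finset.exists_max_image _ Finset.card hne
  simp only [Finset.mem_filter, Finset.mem_univ, true_and] at hS hmax
  obtain ⟨r, hr, hinj⟩ := hS
  refine ⟨S, r, hr, hinj, ?_⟩
  intro x y hxy hx hy hR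
  simp only [Finset.mem_union, Finset.mem_image, not_or, not_exists, not_and] at hx hy
  have := hmax (insert x S) (by
    refine ⟨Function.update r x y, ?_, ?_⟩
    · intro v hv
      by_cases h : v = x
      · subst h
        rw [Function.update_self]
        refine ⟨hR, ?_⟩
        rw [Finset.mem_insert]
        rintro (h | h)
        · exact hxy h.symm
        · exact hy.1 h
      · rw [Function.update_of_ne h]
        have hv' := (Finset.mem_insert.1 hv).resolve_left h
        refine ⟨(hr v hv').1, ?_⟩
        rw [Finset.mem_insert]
        rintro (h | h)
        · exact hx.2 v hv' h
        · exact (hr v hv').2 h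
    · intro a ha b hb hab
      simp only [Finset.coe_insert, Set.mem_insert_iff, Finset.mem_coe] at ha hb
      by_cases h1 : a = x <;> by_cases h2 : b = x
      · rw [h1, h2]
      · subst h1
        rw [Function.update_self, Function.update_of_ne h2] at hab
        exact absurd hab.symm (hy.2 b (hb.resolve_left h2))
      · subst h2
        rw [Function.update_self, Function.update_of_ne h1] at hab
        exact absurd hab (hy.2 a (ha.resolve_left h1))
      · rw [Function.update_of_ne h1, Function.update_of_ne h2] at hab
        exact hinj (ha.resolve_left h1) (hb.resolve_left h2) hab)
  rw [Finset.card_insert_of_notMem hx.1] at this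
  omega

/-- A good folding map. -/
def Good (t : ℕ) {V : Type} [Fintype V] {m : ℕ} (f : V → Fin m) (G : SimpleGraph V) : Prop :=
  Function.Surjective f ∧ (∀ a, (Finset.univ.filter (fun x => f x = a)).card ≤ 2) ∧ Free t (Q f G)

lemma fold {V : Type} [Fintype V] (S : Finset V) (r : V → V) (hr : ∀ v ∈ S, r v ∉ S) (m : ℕ)
    (hm : Fintype.card V = m + S.card) : ∃ (f : V → Fin m) (s : Fin m → V), (∀ a, f (s a) = a) ∧
      (∀ x, s (f x) = if x ∈ S then r x else x) := by
  have hc : Fintype.card {x // x ∉ S} = m := by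
    rw [Fintype.card_subtype_compl, hm, Fintype.card_coe]; omega
  let e : {x // x ∉ S} ≃ Fin m := Fintype.equivFinOfCardEq hc
  refine ⟨fun x => e (if h : x ∈ S then ⟨r x, hr x h⟩ else ⟨x, h⟩), fun a => (e.symm a).1, ?_, ?_⟩
  · intro a
    have := (e.symm a).2
    simp [this]
  · intro x
    by_cases h : x ∈ S <;> simp [h]

lemma good_of {t : ℕ} {V : Type} [Fintype V] (G : SimpleGraph V) (hG : Free t G) (S : Finset V)
    (r : V → V) (hr : ∀ v ∈ S, r v ∉ S) (hinj : Set.InjOn r S)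
    (hR : (∀ v ∈ S, G.Adj v (r v)) ∨ (∀ v ∈ S, nbr G v = nbr G (r v)))
    (k m : ℕ) (hm : Fintype.card V = m + k) (hk : k ≤ S.card) :
    ∃ f : V → Fin m, Good t f G := by
  obtain ⟨S', hS', hc⟩ := Finset.exists_subset_card_eq hk
  obtain ⟨f, s, hfs, hsf⟩ := fold S' r (fun v hv h => hr v (hS' hv) (hS' h)) m (by rw [hc, hm])
  have hinj' : ∀ x y, x ∈ S' → y ∈ S' → r x = r y → x = y :=
    fun x y hx hy h => hinj (hS' hx) (hS' hy) h
  have hr' : ∀ v ∈ S', r v ∉ S' := fun v hv h => hr v (hS' hv) (hS' h)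
  have hsurj : Function.Surjective f := fun a => ⟨s a, hfs a⟩
  refine ⟨f, hsurj, ?_, ?_⟩
  · intro a
    have h1 : Finset.univ.filter (fun x => f x = a) ⊆
        {s a} ∪ S'.filter (fun x => r x = s a) := by
      intro x hx
      simp only [Finset.mem_filter, Finset.mem_univ, true_and] at hx
      have := hsf x
      rw [hx] at this
      simp only [Finset.mem_union, Finset.mem_singleton, Finset.mem_filter]
      grind
    have h2 : (S'.filter (fun x => r x = s a)).card ≤ 1 := by
      rw [Finset.card_le_one]
      intro x hx y hy
      rw [Finset.mem_filter] at hx hy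
      exact hinj' x y hx.1 hy.1 (hx.2.trans hy.2.symm)
    have h3 := (Finset.card_le_card h1).trans (Finset.card_union_le _ _)
    rw [Finset.card_singleton] at h3
    omega
  · refine hG.minor ?_
    rcases hR with hR | hR
    · refine isMinor_Q f hsurj G ?_
      intro x y hxy
      have h1 := hsf x
      have h2 := hsf y
      rw [hxy, h2] at h1
      have a1 : x ∈ S' → G.Adj x (r x) := fun h => hR x (hS' h)
      have a2 : y ∈ S' → G.Adj (r y) y := fun h => (hR y (hS' h)).symm
      grind
    · refine isMinor_Q_section f s hfs G ?_
      intro x y hxy _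
      have tw : ∀ z w, G.Adj z w → G.Adj (s (f z)) w := by
        intro z w h
        rw [hsf]
        split_ifs with hz
        · rw [← mem_nbr, ← hR z (hS' hz), mem_nbr]; exact h
        · exact h
      exact (tw _ _ (tw _ _ hxy).symm).symm

lemma structural (t : ℕ) : ∃ N : ℕ, 0 < N ∧ ∀ (V : Type) [Fintype V] (G : SimpleGraph V),
    Free t G → ∀ m k, Fintype.card V = m + k → N * k ≤ Fintype.card V →
      ∃ f : V → Fin m, Good t f G := by
  obtain ⟨D, hD⟩ := mader t
  refine ⟨6 + 2 * (D + 2 ^ D), by omega, ?_⟩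
  intro V _ G hG m k hm hk
  obtain ⟨S, r, hr, hinj, hmax⟩ := pairing G.Adj
  by_cases hkS : k ≤ S.card
  · exact good_of G hG S r (fun v hv => (hr v hv).2) hinj (Or.inl fun v hv => (hr v hv).1) k m hm hkS
  obtain ⟨S', r', hr', hinj', hmax'⟩ := pairing (fun x y => nbr G x = nbr G y)
  by_cases hkS' : k ≤ S'.card
  · exact good_of G hG S' r' (fun v hv => (hr' v hv).2) hinj'
      (Or.inr fun v hv => (hr' v hv).1) k m hm hkS'
  exfalso
  set B := S ∪ S.image r with hBdef
  set B' := S' ∪ S'.image r' with hBdef'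
  have hB : B.card ≤ 2 * S.card := by
    have h1 := Finset.card_union_le S (S.image r)
    have h2 := Finset.card_image_le (s := S) (f := r)
    rw [hBdef]; omega
  have hB' : B'.card ≤ 2 * S'.card := by
    have h1 := Finset.card_union_le S' (S'.image r')
    have h2 := Finset.card_image_le (s := S') (f := r')
    rw [hBdef']; omega
  have hcount := nbhd_count hD G hG B (fun x y hx hy h => hmax x y h.ne hx hy h)
  have h1 : ((Finset.univ \ B) \ B').card ≤ ((Finset.univ \ B).image (nbr G)).card := by
    refine Finset.card_le_card_of_injOn (nbr G) ?_ ?_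
    · intro x hx
      simp only [Finset.coe_sdiff, Set.mem_sdiff, Finset.mem_coe] at hx
      exact Finset.mem_coe.2 (Finset.mem_image_of_mem _ (by simpa using hx.1))
    · intro x hx y hy hxy
      simp only [Finset.coe_sdiff, Set.mem_sdiff, Finset.mem_coe] at hx hy
      by_contra hne
      exact hmax' x y hne hx.2 hy.2 hxy
  have h2 := Finset.card_le_card_sdiff_add_card (s := Finset.univ \ B) (t := B')
  have h3 := Finset.card_le_card_sdiff_add_card (s := Finset.univ) (t := B)
  rw [Finset.card_univ] at h3
  have h4 : (D + 2 ^ D) * B.card ≤ (D + 2 ^ D) * (2 * k) := Nat.mul_le_mul_left _ (by omega)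
  have h5 : (6 + 2 * (D + 2 ^ D)) * k = 6 * k + (D + 2 ^ D) * (2 * k) := by ring
  omega

/-- The finite set of `K_t`-minor-free graphs on `Fin n`. -/
noncomputable def FF (t n : ℕ) : Finset (SimpleGraph (Fin n)) := Finset.univ.filter (fun G => Free t G)

lemma mem_FF {t n : ℕ} (G : SimpleGraph (Fin n)) : G ∈ FF t n ↔ Free t G := by simp [FF]

lemma pairs_injective {V : Type} [Fintype V] : Function.Injective (pairs (V := V)) := by
  intro G H h
  ext a b
  have := mem_pairs G (a, b)
  rw [h, mem_pairs] at this
  exact this.symm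

lemma good_perm {t : ℕ} {V : Type} [Fintype V] {m : ℕ} (f : V → Fin m) (G : SimpleGraph V)
    (h : Good t f G) (e : Equiv.Perm (Fin m)) : Good t (e ∘ f) G := by
  obtain ⟨h1, h2, h3⟩ := h
  refine ⟨e.surjective.comp h1, fun a => ?_, h3.minor (isMinor_Q_equiv f e G)⟩
  refine le_trans (le_of_eq ?_) (h2 (e.symm a))
  congr 1
  ext x
  simp [Equiv.eq_symm_apply]

lemma blowup_card {n m : ℕ} (f : Fin n → Fin m)
    (hf : ∀ a, (Finset.univ.filter (fun x => f x = a)).card ≤ 2) (G' : SimpleGraph (Fin m)) :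
    (Finset.univ.filter (fun p : Fin n × Fin n => f p.1 = f p.2 ∨ G'.Adj (f p.1) (f p.2))).card ≤
      4 * (m + (pairs G').card) := by
  have h := Finset.card_le_mul_card_image_of_maps_to
    (s := Finset.univ.filter (fun p : Fin n × Fin n => f p.1 = f p.2 ∨ G'.Adj (f p.1) (f p.2)))
    (t := (Finset.univ.image (fun a : Fin m => (a, a))) ∪ pairs G')
    (f := fun p => (f p.1, f p.2)) (by
      rintro ⟨a, b⟩ hab
      simp only [Finset.mem_filter, Finset.mem_univ, true_and] at hab
      simp only [Finset.mem_union, Finset.mem_image, Finset.mem_univ, true_and, mem_pairs,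
        Prod.mk.injEq]
      rcases hab with h | h
      · exact Or.inl ⟨f a, rfl, h⟩
      · exact Or.inr h) 4 (by
      rintro ⟨c, d⟩ -
      have h1 := Nat.mul_le_mul (hf c) (hf d)
      rw [← Finset.card_product] at h1
      refine le_trans (Finset.card_le_card ?_) h1
      rintro ⟨a, b⟩ hab
      simp only [Finset.mem_filter, Finset.mem_univ, true_and, Prod.mk.injEq] at hab
      simp only [Finset.mem_product, Finset.mem_filter, Finset.mem_univ, true_and]
      exact hab.2)
  refine h.trans (Nat.mul_le_mul_left _ ((Finset.card_union_le _ _).trans ?_))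
  have := Finset.card_image_le (s := (Finset.univ : Finset (Fin m))) (f := fun a : Fin m => (a, a))
  rw [Finset.card_univ, Fintype.card_fin] at this
  omega

lemma count {t N D : ℕ} (hD : ∀ (V : Type) [Fintype V] (G : SimpleGraph V), Free t G →
    (pairs G).card ≤ D * Fintype.card V)
    (hN : ∀ (V : Type) [Fintype V] (G : SimpleGraph V),
    Free t G → ∀ m k, Fintype.card V = m + k → N * k ≤ Fintype.card V →
      ∃ f : V → Fin m, Good t f G) (n m k : ℕ) (hn : n = m + k) (hk : N * k ≤ n) :
    (FF t n).card * m ! ≤ 2 ^ (4 * (1 + D) * n) * (n ^ n * (FF t m).card) := by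
  set Z : Finset ((Fin n → Fin m) × SimpleGraph (Fin n)) :=
    Finset.univ.filter (fun z => Good t z.1 z.2) with hZ
  have hZm : ∀ z, z ∈ Z ↔ Good t z.1 z.2 := fun z => by simp [hZ]
  by_cases hm : IsEmpty (Fin n → Fin m)
  · have h0 : FF t n = ∅ := by
      rw [Finset.eq_empty_iff_forall_notMem]
      intro G hG
      obtain ⟨f, -⟩ := hN (Fin n) G ((mem_FF G).1 hG) m k (by simpa using hn) (by simpa using hk)
      exact hm.false f
    rw [h0]; simp
  rw [not_isEmpty_iff] at hm
  have hex : ∀ G : SimpleGraph (Fin n), ∃ f : Fin n → Fin m, Free t G → Good t f G := by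
    intro G
    by_cases hG : Free t G
    · obtain ⟨f, hf⟩ := hN (Fin n) G hG m k (by simpa using hn) (by simpa using hk)
      exact ⟨f, fun _ => hf⟩
    · exact ⟨hm.some, fun h => absurd h hG⟩
  choose f hf using hex
  have step1 : (FF t n).card * m ! ≤ Z.card := by
    have hc : (FF t n ×ˢ (Finset.univ : Finset (Equiv.Perm (Fin m)))).card = (FF t n).card * m ! := by
      rw [Finset.card_product, Finset.card_univ, Fintype.card_perm, Fintype.card_fin]
    rw [← hc]
    refine Finset.card_le_card_of_injOn (fun z => (z.2 ∘ f z.1, z.1)) ?_ ?_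
    · rintro ⟨G, e⟩ h
      simp only [Finset.coe_product, Set.mem_prod, Finset.mem_coe, mem_FF] at h
      exact Finset.mem_coe.2 ((hZm _).2 (good_perm _ _ (hf G h.1) e))
    · rintro ⟨G, e⟩ h ⟨G', e'⟩ h' heq
      simp only [Finset.coe_product, Set.mem_prod, Finset.mem_coe, mem_FF] at h h'
      simp only [Prod.mk.injEq] at heq
      obtain ⟨h1, rfl⟩ := heq
      have hs := (hf G h.1).1
      have : e = e' := by
        ext1 a
        obtain ⟨x, rfl⟩ := hs a
        exact congrFun h1 x
      rw [this]
  have step2 := Finset.card_le_mul_card_image_of_maps_to (s := Z)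
    (t := (Finset.univ : Finset (Fin n → Fin m)) ×ˢ FF t m)
    (f := fun z => (z.1, Q z.1 z.2)) (by
      intro z hz
      simp only [Finset.mem_product, Finset.mem_univ, true_and, mem_FF]
      exact ((hZm z).1 hz).2.2) (2 ^ (4 * (1 + D) * n)) (by
      rintro ⟨g, G'⟩ hG'
      simp only [Finset.mem_product, Finset.mem_univ, true_and, mem_FF] at hG'
      by_cases hg : ∀ a, (Finset.univ.filter (fun x => g x = a)).card ≤ 2
      · have hb := blowup_card g hg G'
        have hp := hD _ G' hG'
        rw [Fintype.card_fin] at hp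
        set L := Finset.univ.filter (fun p : Fin n × Fin n => g p.1 = g p.2 ∨ G'.Adj (g p.1) (g p.2))
          with hL
        have hLc : L.card ≤ 4 * (1 + D) * n := by
          have : D * m ≤ D * n := Nat.mul_le_mul_left _ (by omega)
          nlinarith
        refine le_trans ?_ (Nat.pow_le_pow_right (by norm_num) hLc)
        rw [← Finset.card_powerset]
        refine Finset.card_le_card_of_injOn (fun z => pairs z.2) ?_ ?_
        · rintro ⟨g', G⟩ h
          simp only [Finset.coe_filter, Set.mem_ofPred_eq, Prod.mk.injEq] at h
          obtain ⟨-, rfl, rfl⟩ := h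
          rw [Finset.mem_coe, Finset.mem_powerset]
          rintro ⟨a, b⟩ hab
          rw [mem_pairs] at hab
          simp only [hL, Finset.mem_filter, Finset.mem_univ, true_and]
          by_cases he : g' a = g' b
          · exact Or.inl he
          · exact Or.inr ⟨he, a, b, rfl, rfl, hab⟩
        · rintro ⟨g', G⟩ h ⟨g'', G''⟩ h' heq
          simp only [Finset.coe_filter, Set.mem_ofPred_eq, Prod.mk.injEq] at h h'
          have hGG : G = G'' := pairs_injective heq
          rw [h.2.1, h'.2.1, hGG]
      · rw [Finset.card_eq_zero.2]
        · exact Nat.zero_le _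
        · rw [Finset.filter_eq_empty_iff]
          rintro ⟨g', G⟩ hz h
          simp only [Prod.mk.injEq] at h
          obtain ⟨rfl, -⟩ := h
          exact hg ((hZm _).1 hz).2.1)
  refine step1.trans (step2.trans (Nat.mul_le_mul_left _ ?_))
  rw [Finset.card_product, Finset.card_univ, Fintype.card_fun, Fintype.card_fin, Fintype.card_fin]
  exact Nat.mul_le_mul_right _ (Nat.pow_le_pow_left (by omega) _)

lemma card_FF_le (t n : ℕ) : (FF t n).card ≤ 2 ^ (n * n) := by
  have : (2 : ℕ) ^ (n * n) = (Finset.univ : Finset (Fin n × Fin n)).powerset.card := by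
    rw [Finset.card_powerset, Finset.card_univ, Fintype.card_prod, Fintype.card_fin]
  rw [this]
  exact Finset.card_le_card_of_injOn pairs (fun G _ => by simp) pairs_injective.injOn

lemma final (t : ℕ) : ∃ c : ℝ, ∀ n : ℕ, ((FF t n).card : ℝ) ≤ c ^ n * (n ! : ℕ) := by
  obtain ⟨D, hD⟩ := mader t
  obtain ⟨N, hN0, hN⟩ := structural t
  set K : ℝ := 2 ^ (4 * (1 + D)) * Real.exp 1 with hK
  have hexp : (1 : ℝ) ≤ Real.exp 1 := Real.one_le_exp (by norm_num)
  have hK1 : 1 ≤ K := by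
    have : (1 : ℝ) ≤ 2 ^ (4 * (1 + D)) := one_le_pow₀ (by norm_num)
    nlinarith
  have hK2 : 1 ≤ 2 * K := by linarith
  clear_value K
  refine ⟨(2 * K) ^ (2 * N), ?_⟩
  intro n
  induction n using Nat.strong_induction_on with
  | _ n ih =>
    have hfac : (1 : ℝ) ≤ (n ! : ℕ) := by exact_mod_cast Nat.factorial_pos n
    by_cases hn : n < N
    · have h1 : ((FF t n).card : ℝ) ≤ 2 ^ (n * n) := by exact_mod_cast card_FF_le t n
      have h2 : (2 : ℝ) ^ (n * n) ≤ (2 * K) ^ (n * n) := by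
        apply pow_le_pow_left₀ (by norm_num); linarith
      have h3 : (2 * K) ^ (n * n) ≤ (2 * K) ^ (2 * N * n) :=
        pow_le_pow_right₀ hK2 (Nat.mul_le_mul_right _ (by omega))
      rw [pow_mul _ (2 * N) n] at h3
      have h4 : (0 : ℝ) ≤ ((2 * K) ^ (2 * N)) ^ n := by positivity
      nlinarith
    · push Not at hn
      set k := n / N with hk
      have hk1 : 1 ≤ k := (Nat.one_le_div_iff hN0).2 hn
      have hkn : N * k ≤ n := Nat.mul_div_le n N
      have hkn' : k ≤ n := Nat.div_le_self n N
      have hlt : n < N * (k + 1) := by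
        have := Nat.lt_mul_div_succ n hN0
        exact this
      have h2N : n ≤ 2 * N * k := by nlinarith
      obtain ⟨m, hm⟩ : ∃ m, n = m + k := ⟨n - k, by omega⟩
      have hc := count hD hN n m k hm hkn
      have him := ih m (by omega)
      have hcR : ((FF t n).card : ℝ) * (m ! : ℕ) ≤
          2 ^ (4 * (1 + D) * n) * ((n : ℝ) ^ n * (FF t m).card) := by exact_mod_cast hc
      have hnn : (n : ℝ) ^ n ≤ Real.exp 1 ^ n * (n ! : ℕ) := by
        have := Real.pow_div_factorial_le_exp (x := (n : ℝ)) (by positivity) n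
        rw [div_le_iff₀ (by positivity)] at this
        rw [← Real.exp_nat_mul, mul_one]
        exact this
      have hmfac : (0 : ℝ) < (m ! : ℕ) := by exact_mod_cast Nat.factorial_pos m
      have h1 : (2 : ℝ) ^ (4 * (1 + D) * n) * ((n : ℝ) ^ n * (FF t m).card) ≤
          2 ^ (4 * (1 + D) * n) * ((Real.exp 1 ^ n * (n ! : ℕ)) *
            (((2 * K) ^ (2 * N)) ^ m * (m ! : ℕ))) :=
        mul_le_mul_of_nonneg_left
          (mul_le_mul hnn him (Nat.cast_nonneg _) (by positivity)) (by positivity)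
      have h2 : (2 : ℝ) ^ (4 * (1 + D) * n) * ((Real.exp 1 ^ n * (n ! : ℕ)) *
            (((2 * K) ^ (2 * N)) ^ m * (m ! : ℕ))) =
            (K ^ n * ((2 * K) ^ (2 * N)) ^ m * (n ! : ℕ)) * (m ! : ℕ) := by
        rw [hK, mul_pow _ _ n, ← pow_mul 2]
        ring
      have h3 : ((FF t n).card : ℝ) ≤ K ^ n * ((2 * K) ^ (2 * N)) ^ m * (n ! : ℕ) := by
        refine le_of_mul_le_mul_right ?_ hmfac
        rw [← h2]
        exact hcR.trans h1
      refine h3.trans ?_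
      have h4 : K ^ n ≤ ((2 * K) ^ (2 * N)) ^ k := by
        rw [← pow_mul]
        calc K ^ n ≤ (2 * K) ^ n := by
              apply pow_le_pow_left₀ (by linarith); linarith
          _ ≤ _ := pow_le_pow_right₀ hK2 h2N
      have h5 : ((2 * K) ^ (2 * N)) ^ n = ((2 * K) ^ (2 * N)) ^ k * ((2 * K) ^ (2 * N)) ^ m := by
        rw [← pow_add]; congr 1; omega
      rw [h5]
      gcongr

end
end MinorSmall

/-- Every proper minor-closed class of labelled graphs is small: there is a
constant `c` with `|A_n| ≤ cⁿ · n!` for all `n`. -/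
theorem minor_closed_is_small (A : ∀ n : ℕ, Set (SimpleGraph (Fin n)))
    (hminor : ∀ (n m : ℕ) (G : SimpleGraph (Fin n)) (H : SimpleGraph (Fin m)),
      G ∈ A n → IsMinor H G → H ∈ A m)
    (hproper : ∃ (n : ℕ) (G : SimpleGraph (Fin n)), G ∉ A n) :
    ∃ c : ℝ, ∀ n : ℕ, (Nat.card (A n) : ℝ) ≤ c ^ n * (n ! : ℕ) := by
  obtain ⟨t, G₀, hG₀⟩ := hproper
  obtain ⟨c, hc⟩ := MinorSmall.final t
  refine ⟨c, fun n => le_trans ?_ (hc n)⟩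
  have hsub : A n ⊆ (MinorSmall.FF t n : Set (SimpleGraph (Fin n))) := by
    intro G hG
    rw [Finset.mem_coe, MinorSmall.mem_FF]
    rintro ⟨B, h1, h2, h3, h4⟩
    exact hG₀ (hminor n t G G₀ hG ⟨B, h1, h2, h3, fun u u' h => h4 h.ne⟩)
  have := Set.ncard_le_ncard hsub (Finset.finite_toSet _)
  rw [Set.ncard_coe_finset] at this
  exact_mod_cast this
end
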